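/- Let (R,𝔪) be a Noetherian local ring and 𝔞 ⊊ R a proper ideal such that R is relative Cohen-Macaulay with respect to 𝔞 with c = cd(𝔞,R). Then K^c_𝔞(R) = D_R(H^c_𝔞(R)) is a faithful R-module (Ann_R K^c_𝔞(R) = 0), is relative Cohen-Macaulay with respect to 𝔞, and has finite injective dimension. -/

import Mathlib

open CategoryTheory

noncomputable section

/-- The cohomological dimension `cd(𝔞, M)`: the supremum (in `ℕ`) of the set of
indices `i` with `H^i_𝔞(M) ≠ 0`, local cohomology being taken w.r.t. `𝔞`. -/
def cohDim {R : Type} [CommRing R] (I : Ideal R) (M : Type) [AddCommGroup M] [Module R M] : ℕ :=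
  sSup {i : ℕ | Nontrivial ((localCohomology I i).obj (ModuleCat.of R M))}

/-- `M` is relative Cohen-Macaulay w.r.t. `𝔞` if there is precisely one non-vanishing
local cohomology module of `M` w.r.t. `𝔞`. -/
def IsRelCM {R : Type} [CommRing R] (I : Ideal R) (M : Type) [AddCommGroup M] [Module R M] :
    Prop :=
  ∃ c : ℕ, ∀ i : ℕ, Nontrivial ((localCohomology I i).obj (ModuleCat.of R M)) ↔ i = c

/-- `f : K →ₗ[R] E` exhibits `E` as an injective hull of `K`:
`E` is an injective module and `f` is an essential monomorphism. -/
structure IsInjectiveHull (R : Type) [CommRing R] {K E : Type} [AddCommGroup K] [Module R K]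
    [AddCommGroup E] [Module R E] (f : K →ₗ[R] E) : Prop where
  injective : Module.Injective R E
  inj : Function.Injective f
  essential : ∀ N : Submodule R E, N ≠ ⊥ → N ⊓ LinearMap.range f ≠ ⊥

/-- `F` is the cohomological dimension filtration (cd-filtration) of `M` in the range
`0 ≤ i ≤ c`: `F i` is the largest submodule of `M` of cohomological dimension `≤ i`. -/
def IsCdFiltration {R : Type} [CommRing R] (I : Ideal R) {M : Type} [AddCommGroup M]
    [Module R M] (c : ℕ) (F : ℕ → Submodule R M) : Prop :=
  ∀ i ≤ c, cohDim I (F i) ≤ i ∧ ∀ N : Submodule R M, cohDim I N ≤ i → N ≤ F i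

/-- The `i`-th factor `M_i / M_{i-1}` of a filtration `F` of `M`. -/
def filtFactor {R : Type} [CommRing R] {M : Type} [AddCommGroup M] [Module R M]
    (F : ℕ → Submodule R M) (i : ℕ) : Type :=
  ↥(F i) ⧸ Submodule.comap (F i).subtype (F (i - 1))

instance {R : Type} [CommRing R] {M : Type} [AddCommGroup M] [Module R M]
    (F : ℕ → Submodule R M) (i : ℕ) : AddCommGroup (filtFactor F i) :=
  inferInstanceAs (AddCommGroup (↥(F i) ⧸ Submodule.comap (F i).subtype (F (i - 1))))

instance {R : Type} [CommRing R] {M : Type} [AddCommGroup M] [Module R M]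
    (F : ℕ → Submodule R M) (i : ℕ) : Module R (filtFactor F i) :=
  inferInstanceAs (Module R (↥(F i) ⧸ Submodule.comap (F i).subtype (F (i - 1))))

/-- `M` is a relative Cohen-Macaulay filtered (RCMF) module w.r.t. `𝔞`: every factor
`M_i/M_{i-1}` (`1 ≤ i ≤ c = cd(𝔞,M)`) of its cd-filtration is either zero or an
`i`-cohomological dimensional relative Cohen-Macaulay module w.r.t. `𝔞`. -/
def IsRCMF {R : Type} [CommRing R] (I : Ideal R) (M : Type) [AddCommGroup M] [Module R M] :
    Prop :=
  ∀ F : ℕ → Submodule R M, IsCdFiltration I (cohDim I M) F →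
    ∀ i : ℕ, 1 ≤ i → i ≤ cohDim I M →
      Subsingleton (filtFactor F i) ∨
        (IsRelCM I (filtFactor F i) ∧ cohDim I (filtFactor F i) = i)

end

/-- `K` has finite injective dimension over `R`: there is an `n` such that
`Ext^j_R(N, K) = 0` for every `R`-module `N` and every `j > n`. -/
def HasFiniteInjectiveDimension (R : Type) [CommRing R] (K : Type) [AddCommGroup K]
    [Module R K] : Prop :=
  ∃ n : ℕ, ∀ j : ℕ, n < j → ∀ N : ModuleCat R,
    Subsingleton (((Ext R (ModuleCat R) j).obj (Opposite.op N)).obj (ModuleCat.of R K))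


namespace RelCM
open HomologicalComplex

lemma cyc_exists {R : Type} [CommRing R] (K : CochainComplex (ModuleCat.{0} R) ℕ) (n : ℕ)
    (x : K.X n) (hx : K.d n (n+1) x = 0) : ∃ z : K.cycles n, K.iCycles n z = x :=
  ⟨K.cyclesMk x (n+1) (by simp) hx, K.i_cyclesMk x (n+1) (by simp) hx⟩

lemma hompi_eq_zero_iff {R : Type} [CommRing R] (K : CochainComplex (ModuleCat.{0} R) ℕ) (m n : ℕ)
    (hm : (ComplexShape.up ℕ).prev n = m)
    (z : K.cycles n) : K.homologyπ n z = 0 ↔ ∃ y : K.X m, K.d m n y = K.iCycles n z := by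
  have hex := (ShortComplex.moduleCat_exact_iff _).1
    (ShortComplex.exact_of_g_is_cokernel (ShortComplex.mk _ _ (K.toCycles_comp_homologyπ m n))
      (K.homologyIsCokernel m n hm))
  have hinj : Function.Injective (K.iCycles n) := (ModuleCat.mono_iff_injective _).1 inferInstance
  constructor
  · intro h
    obtain ⟨y, hy⟩ := hex z h
    refine ⟨y, ?_⟩
    have h2 := ConcreteCategory.congr_hom (K.toCycles_i m n) y
    rw [← h2]
    exact congrArg (K.iCycles n) hy
  · rintro ⟨y, hy⟩
    have h2 := ConcreteCategory.congr_hom (K.toCycles_i m n) y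
    have h3 : K.toCycles m n y = z := hinj (h2.trans hy)
    rw [← h3]
    exact ConcreteCategory.congr_hom (K.toCycles_comp_homologyπ m n) y

lemma homologyUnop_nat {V : Type*} [Category V] [Abelian V] {ι : Type*} {c : ComplexShape ι}
    {K L : HomologicalComplex Vᵒᵖ c} (φ : K ⟶ L) (i : ι) :
    homologyMap ((unopFunctor _ _).map φ.op) i ≫ (homologyUnop K i).hom =
      (homologyUnop L i).hom ≫ (homologyMap φ i).unop := by
  apply Quiver.Hom.op_inj
  have := homologyOp_hom_naturality ((unopFunctor _ _).map φ.op) i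
  exact this.symm

lemma extMk_eq_zero_iff_zero {C : Type*} [Category C] [Abelian C] [HasExt C] {X Y : C}
    (P : ProjectiveResolution X) (f : P.complex.X 0 ⟶ Y) (m : ℕ) (hm : 0 + 1 = m)
    (hf : P.complex.d m 0 ≫ f = 0) (h : P.extMk f m hm hf = 0) : f = 0 := by
  rw [← P.extEquivCohomologyClass.apply_eq_iff_eq,
    ProjectiveResolution.extEquivCohomologyClass_extMk,
    ProjectiveResolution.extEquivCohomologyClass_zero,
    CochainComplex.HomComplex.CohomologyClass.mk_eq_zero_iff,
    CochainComplex.HomComplex.Cocycle.toSingleMk_mem_coboundaries_iff _ _ _ _ _ 1 (by simp)] at h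
  obtain ⟨g, hg⟩ := h
  have hz : g = 0 := (CochainComplex.isZero_of_isStrictlyLE P.cochainComplex 0 1).eq_of_src _ _
  rw [hz, Limits.comp_zero] at hg
  rw [← cancel_epi (P.cochainComplexXIso (-((0:ℕ):ℤ)) 0 rfl).hom, ← hg, Limits.comp_zero]

variable {R : Type} [CommRing R]

/-- cocycles as morphisms -/
noncomputable def cocy {X : ModuleCat.{0} R} (P : ProjectiveResolution X) (M : ModuleCat.{0} R)
    (n : ℕ) : (P.complex.linearYonedaObj R M).cycles n →ₗ[R] (P.complex.X n ⟶ M) :=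
  ((P.complex.linearYonedaObj R M).iCycles n).hom

lemma cocy_d {X : ModuleCat.{0} R} (P : ProjectiveResolution X) (M : ModuleCat.{0} R)
    (n : ℕ) (z : (P.complex.linearYonedaObj R M).cycles n) :
    P.complex.d (n+1) n ≫ cocy P M n z = 0 :=
  ConcreteCategory.congr_hom ((P.complex.linearYonedaObj R M).iCycles_d n (n+1)) z

/-- comparison on cocycles -/
noncomputable def cycToExt {X : ModuleCat.{0} R} (P : ProjectiveResolution X) (M : ModuleCat.{0} R)
    (n : ℕ) : (P.complex.linearYonedaObj R M).cycles n →ₗ[R] Abelian.Ext X M n where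
  toFun z := P.extMk (cocy P M n z) (n+1) rfl (cocy_d P M n z)
  map_add' x y := by
    rw [ProjectiveResolution.add_extMk]
    congr 1
    exact map_add _ _ _
  map_smul' r x := by
    rw [RingHom.id_apply, Abelian.Ext.smul_eq_comp_mk₀, ProjectiveResolution.extMk_comp_mk₀]
    congr 1
    refine (map_smul _ _ _).trans ?_
    rw [Linear.comp_smul, Category.comp_id]

lemma cycToExt_apply {X : ModuleCat.{0} R} (P : ProjectiveResolution X) (M : ModuleCat.{0} R)
    (n : ℕ) (z : (P.complex.linearYonedaObj R M).cycles n) (f : P.complex.X n ⟶ M)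
    (h : cocy P M n z = f) (hf : P.complex.d (n+1) n ≫ f = 0) :
    cycToExt P M n z = P.extMk f (n+1) rfl hf := by
  subst h; rfl

lemma cycToExt_surj {X : ModuleCat.{0} R} (P : ProjectiveResolution X) (M : ModuleCat.{0} R)
    (n : ℕ) : Function.Surjective (cycToExt P M n) := by
  intro α
  obtain ⟨f, hf, rfl⟩ := P.extMk_surjective α (n+1) rfl
  obtain ⟨z, hz⟩ := cyc_exists (P.complex.linearYonedaObj R M) n f hf
  exact ⟨z, cycToExt_apply P M n z f hz hf⟩

lemma cycToExt_ker {X : ModuleCat.{0} R} (P : ProjectiveResolution X) (M : ModuleCat.{0} R)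
    (n : ℕ) : LinearMap.ker ((P.complex.linearYonedaObj R M).homologyπ n).hom =
      LinearMap.ker (cycToExt P M n) := by
  ext z
  rw [LinearMap.mem_ker, LinearMap.mem_ker]
  cases n with
  | zero =>
    refine (hompi_eq_zero_iff _ 0 0 (by simp) z).trans ?_
    constructor
    · rintro ⟨y, hy⟩
      rw [cycToExt_apply P M 0 z 0 (by
        refine hy.symm.trans ?_
        rw [HomologicalComplex.shape _ _ _ (by simp)]; rfl) (by simp)]
      simp
    · intro h
      have := extMk_eq_zero_iff_zero P _ _ rfl (cocy_d P M 0 z) h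
      exact ⟨0, by rw [map_zero]; exact this.symm⟩
  | succ m =>
    refine (hompi_eq_zero_iff _ m (m+1) (by simp) z).trans ?_
    exact (P.extMk_eq_zero_iff (cocy P M (m+1) z) (m+1+1) rfl (cocy_d P M (m+1) z) m rfl).symm

/-- new Ext vs homology -/
noncomputable def homEquivExt {X : ModuleCat.{0} R} (P : ProjectiveResolution X)
    (M : ModuleCat.{0} R) (n : ℕ) :
    (P.complex.linearYonedaObj R M).homology n ≃ₗ[R] Abelian.Ext X M n :=
  (LinearMap.quotKerEquivOfSurjective ((P.complex.linearYonedaObj R M).homologyπ n).hom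
    ((ModuleCat.epi_iff_surjective _).1 inferInstance)).symm.trans
  ((Submodule.quotEquivOfEq _ _ (cycToExt_ker P M n)).trans
    (LinearMap.quotKerEquivOfSurjective (cycToExt P M n) (cycToExt_surj P M n)))

lemma homEquivExt_pi {X : ModuleCat.{0} R} (P : ProjectiveResolution X)
    (M : ModuleCat.{0} R) (n : ℕ) (z : (P.complex.linearYonedaObj R M).cycles n) :
    homEquivExt P M n ((P.complex.linearYonedaObj R M).homologyπ n z) = cycToExt P M n z := by
  unfold homEquivExt
  have : (LinearMap.quotKerEquivOfSurjective ((P.complex.linearYonedaObj R M).homologyπ n).hom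
    ((ModuleCat.epi_iff_surjective _).1 inferInstance)).symm
    ((P.complex.linearYonedaObj R M).homologyπ n z) = Submodule.Quotient.mk z := by
    rw [LinearEquiv.symm_apply_eq]; rfl
  simp only [LinearEquiv.trans_apply]
  rw [this]
  rfl

/-- chain map induced on Hom complexes -/
noncomputable def lyMap {X X' : ModuleCat.{0} R} {P : ProjectiveResolution X}
    {P' : ProjectiveResolution X'} (φ : P'.complex ⟶ P.complex) (M : ModuleCat.{0} R) :
    P.complex.linearYonedaObj R M ⟶ P'.complex.linearYonedaObj R M :=
  (unopFunctor _ _).map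
    ((((linearYoneda R (ModuleCat.{0} R)).obj M).rightOp.mapHomologicalComplex _).map φ).op

lemma homEquivExt_nat {X X' : ModuleCat.{0} R} (P : ProjectiveResolution X)
    (P' : ProjectiveResolution X') {g : X' ⟶ X} (φ : ProjectiveResolution.Hom P' P g)
    (M : ModuleCat.{0} R) (n : ℕ) (x : (P.complex.linearYonedaObj R M).homology n) :
    homEquivExt P' M n (homologyMap (lyMap φ.hom M) n x) =
      (Abelian.Ext.mk₀ g).comp (homEquivExt P M n x) (zero_add n) := by
  obtain ⟨z, rfl⟩ : ∃ z, (P.complex.linearYonedaObj R M).homologyπ n z = x :=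
    (ModuleCat.epi_iff_surjective _).1 inferInstance x
  have h := ConcreteCategory.congr_hom (homologyπ_naturality (lyMap φ.hom M) n) z
  have h2 := ConcreteCategory.congr_hom (cyclesMap_i (lyMap φ.hom M) n) z
  rw [homEquivExt_pi]
  refine (congrArg _ h).trans ?_
  refine (homEquivExt_pi P' M n _).trans ?_
  rw [cycToExt_apply P M n z _ rfl (cocy_d P M n z), ProjectiveResolution.mk₀_comp_extMk (φ := φ)]
  exact cycToExt_apply _ _ _ _ _ h2 _

/-- old Ext vs new Ext -/
noncomputable def oldNew (X M : ModuleCat.{0} R) (n : ℕ) :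
    ((Ext R (ModuleCat.{0} R) n).obj (Opposite.op X)).obj M ≃ₗ[R] Abelian.Ext X M n :=
  ((projectiveResolution X).isoExt n M).toLinearEquiv.trans
    (homEquivExt (projectiveResolution X) M n)

lemma iso_aux {C : Type*} [Category C] {A A' H H' G G' : C} (α : A ⟶ A') (e : A ≅ H) (e' : A' ≅ H')
    (u : G ≅ H) (u' : G' ≅ H') (β : H ⟶ H') (γ : G ⟶ G') (h1 : α ≫ e'.hom = e.hom ≫ β)
    (h2 : γ ≫ u'.hom = u.hom ≫ β) :
    α ≫ (e' ≪≫ u'.symm).hom = (e ≪≫ u.symm).hom ≫ γ := by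
  rw [← cancel_mono u'.hom]
  simp [h2, h1]

lemma isoExt_nat {X X' : ModuleCat.{0} R} (g : X' ⟶ X) (M : ModuleCat.{0} R) (n : ℕ)
    (P : ProjectiveResolution X) (P' : ProjectiveResolution X') (φ : P'.complex ⟶ P.complex)
    (comm : φ.f 0 ≫ P.π.f 0 = P'.π.f 0 ≫ g) :
    ((Ext R (ModuleCat.{0} R) n).map g.op).app M ≫ (P'.isoExt n M).hom =
      (P.isoExt n M).hom ≫ homologyMap (lyMap φ M) n := by
  have h1 := ProjectiveResolution.isoLeftDerivedObj_inv_naturality g P' P φ comm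
    ((linearYoneda R (ModuleCat.{0} R)).obj M).rightOp n
  have h2 := homologyUnop_nat
    ((((linearYoneda R (ModuleCat.{0} R)).obj M).rightOp.mapHomologicalComplex _).map φ) n
  have h1' := congrArg Quiver.Hom.unop h1
  exact iso_aux _ (P.isoLeftDerivedObj _ n).unop.symm (P'.isoLeftDerivedObj _ n).unop.symm _ _ _ _ h1' h2

lemma oldNew_nat {X X' : ModuleCat.{0} R} (g : X' ⟶ X) (M : ModuleCat.{0} R) (n : ℕ)
    (x : ((Ext R (ModuleCat.{0} R) n).obj (Opposite.op X)).obj M) :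
    oldNew X' M n (((Ext R (ModuleCat.{0} R) n).map g.op).app M x) =
      (Abelian.Ext.mk₀ g).comp (oldNew X M n x) (zero_add n) := by
  let P := projectiveResolution X
  let P' := projectiveResolution X'
  let φ : ProjectiveResolution.Hom P' P g := ⟨ProjectiveResolution.lift g P' P, by
    rw [ProjectiveResolution.lift_commutes_zero]; simp⟩
  have h := ConcreteCategory.congr_hom (isoExt_nat g M n P P' φ.hom
    (ProjectiveResolution.lift_commutes_zero g P' P)) x
  have h2 := homEquivExt_nat P P' φ M n ((P.isoExt n M).hom x)
  exact (congrArg _ h).trans h2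

end RelCM

namespace RelCM
open Abelian
variable {R : Type} [CommRing R]

/-- R/I^n -/
abbrev Qm (I : Ideal R) (n : ℕ) : ModuleCat.{0} R := ModuleCat.of R (R ⧸ I ^ n)

/-- transition -/
noncomputable def qmap (I : Ideal R) {m n : ℕ} (h : m ≤ n) : Qm I n ⟶ Qm I m :=
  ModuleCat.ofHom (Submodule.mapQ (I ^ n) (I ^ m) LinearMap.id (Ideal.pow_le_pow_right h))

lemma qmap_comp (I : Ideal R) {m n k : ℕ} (h : m ≤ n) (h' : n ≤ k) :
    qmap I h' ≫ qmap I h = qmap I (h.trans h') := by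
  ext
  rfl

lemma qmap_id (I : Ideal R) {n : ℕ} (h : n ≤ n) : qmap I h = 𝟙 _ := by
  ext
  rfl

/-- transition on Ext -/
noncomputable abbrev etr (I : Ideal R) (M : ModuleCat.{0} R) (i : ℕ) (m n : ℕ) (h : m ≤ n) :
    Ext (Qm I m) M i →ₗ[R] Ext (Qm I n) M i :=
  (Ext.mk₀ (qmap I h)).precompOfLinear R M (zero_add i)

lemma etr_apply (I : Ideal R) (M : ModuleCat.{0} R) (i : ℕ) (m n : ℕ) (h : m ≤ n)
    (x : Ext (Qm I m) M i) : etr I M i m n h x = (Ext.mk₀ (qmap I h)).comp x (zero_add i) := rfl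

instance (I : Ideal R) (M : ModuleCat.{0} R) (i : ℕ) :
    DirectedSystem (fun n => Ext (Qm I n) M i) (fun m n h => etr I M i m n h) where
  map_self n x := by
    rw [etr_apply, qmap_id, Ext.mk₀_id_comp]
  map_map m n k h h' x := by
    rw [etr_apply, etr_apply, etr_apply, Ext.mk₀_comp_mk₀_assoc, qmap_comp]

/-- local cohomology -/
def LC (I : Ideal R) (i : ℕ) (M : ModuleCat.{0} R) : Type :=
  Module.DirectLimit (fun n => Ext (Qm I n) M i) (etr I M i)

noncomputable instance (I : Ideal R) (i : ℕ) (M : ModuleCat.{0} R) : AddCommGroup (LC I i M) :=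
  inferInstanceAs (AddCommGroup (Module.DirectLimit (fun n => Ext (Qm I n) M i) (etr I M i)))

noncomputable instance (I : Ideal R) (i : ℕ) (M : ModuleCat.{0} R) : Module R (LC I i M) :=
  inferInstanceAs (Module R (Module.DirectLimit (fun n => Ext (Qm I n) M i) (etr I M i)))

/-- canonical map -/
noncomputable def lof (I : Ideal R) (i : ℕ) (M : ModuleCat.{0} R) (n : ℕ) :
    Ext (Qm I n) M i →ₗ[R] LC I i M :=
  Module.DirectLimit.of R ℕ (fun n => Ext (Qm I n) M i) (etr I M i) n

variable {I : Ideal R}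

lemma exists_lof {i : ℕ} {M : ModuleCat.{0} R} (z : LC I i M) : ∃ n x, lof I i M n x = z :=
  Module.DirectLimit.exists_of z

lemma lof_etr {i : ℕ} {M : ModuleCat.{0} R} {m n : ℕ} (h : m ≤ n) (x : Ext (Qm I m) M i) :
    lof I i M n ((Ext.mk₀ (qmap I h)).comp x (zero_add i)) = lof I i M m x :=
  Module.DirectLimit.of_f (f := etr I M i) (hij := h)

lemma lof_eq_zero {i : ℕ} {M : ModuleCat.{0} R} {m : ℕ} {x : Ext (Qm I m) M i}
    (hx : lof I i M m x = 0) : ∃ (n : ℕ) (h : m ≤ n),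
      (Ext.mk₀ (qmap I h)).comp x (zero_add i) = 0 :=
  Module.DirectLimit.of.zero_exact (f := etr I M i) hx

/-- maps induced by Ext classes -/
noncomputable def lcomp {M N : ModuleCat.{0} R} {k : ℕ} (I : Ideal R) (β : Ext M N k) {i j : ℕ}
    (h : i + k = j) : LC I i M →ₗ[R] LC I j N :=
  Module.DirectLimit.map (f := etr I M i) (f' := etr I N j)
    (fun n => β.postcompOfLinear R (Qm I n) h) (by
      intro m n hmn
      ext x
      exact Ext.comp_assoc _ _ _ (zero_add i) h (by omega))

lemma lcomp_lof {M N : ModuleCat.{0} R} {k : ℕ} (β : Ext M N k) {i j : ℕ}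
    (h : i + k = j) (n : ℕ) (x : Ext (Qm I n) M i) :
    lcomp I β h (lof I i M n x) = lof I j N n (x.comp β h) :=
  Module.DirectLimit.map_apply_of (f := etr I M i) (f' := etr I N j) _ _ _

lemma lcomp_lcomp {M N P : ModuleCat.{0} R} {k k' k'' : ℕ} (β : Ext M N k) (γ : Ext N P k')
    {i j l : ℕ} (h : i + k = j) (h' : j + k' = l) (h'' : k + k' = k'') (z : LC I i M) :
    lcomp I γ h' (lcomp I β h z) = lcomp I (β.comp γ h'') (by omega) z := by
  obtain ⟨n, x, rfl⟩ := exists_lof z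
  rw [lcomp_lof, lcomp_lof, lcomp_lof, Ext.comp_assoc _ _ _ h h'' (by omega)]

lemma lcomp_zero {M N : ModuleCat.{0} R} {k : ℕ} {i j : ℕ}
    (h : i + k = j) (z : LC I i M) : lcomp I (0 : Ext M N k) h z = 0 := by
  obtain ⟨n, x, rfl⟩ := exists_lof z
  rw [lcomp_lof, Ext.comp_zero, map_zero]

lemma lcomp_add {M N : ModuleCat.{0} R} {k : ℕ} (β γ : Ext M N k) {i j : ℕ}
    (h : i + k = j) (z : LC I i M) : lcomp I (β + γ) h z = lcomp I β h z + lcomp I γ h z := by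
  obtain ⟨n, x, rfl⟩ := exists_lof z
  simp only [lcomp_lof, Ext.comp_add, map_add]

lemma lcomp_smul {M N : ModuleCat.{0} R} {k : ℕ} (r : R) (β : Ext M N k) {i j : ℕ}
    (h : i + k = j) (z : LC I i M) : lcomp I (r • β) h z = r • lcomp I β h z := by
  obtain ⟨n, x, rfl⟩ := exists_lof z
  simp only [lcomp_lof, Ext.comp_smul, map_smul]

/-- functoriality -/
noncomputable def lmap (I : Ideal R) (i : ℕ) {M N : ModuleCat.{0} R} (g : M ⟶ N) :
    LC I i M →ₗ[R] LC I i N := lcomp I (Ext.mk₀ g) (add_zero i)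

lemma lmap_lof {M N : ModuleCat.{0} R} (g : M ⟶ N) {i : ℕ} (n : ℕ) (x : Ext (Qm I n) M i) :
    lmap I i g (lof I i M n x) = lof I i N n (x.comp (Ext.mk₀ g) (add_zero i)) := lcomp_lof _ _ _ _

lemma lmap_lmap {M N P : ModuleCat.{0} R} (g : M ⟶ N) (g' : N ⟶ P) {i : ℕ} (z : LC I i M) :
    lmap I i g' (lmap I i g z) = lmap I i (g ≫ g') z := by
  unfold lmap
  rw [lcomp_lcomp _ _ _ _ (add_zero 0), Ext.mk₀_comp_mk₀]

lemma lmap_id {M : ModuleCat.{0} R} {i : ℕ} (z : LC I i M) : lmap I i (𝟙 M) z = z := by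
  obtain ⟨n, x, rfl⟩ := exists_lof z
  rw [lmap_lof, Ext.comp_mk₀_id]

lemma lmap_zero {M N : ModuleCat.{0} R} {i : ℕ} (z : LC I i M) : lmap I i (0 : M ⟶ N) z = 0 := by
  unfold lmap; rw [Ext.mk₀_zero, lcomp_zero]

lemma lmap_add {M N : ModuleCat.{0} R} (g g' : M ⟶ N) {i : ℕ} (z : LC I i M) :
    lmap I i (g + g') z = lmap I i g z + lmap I i g' z := by
  unfold lmap; rw [Ext.mk₀_add, lcomp_add]

lemma lmap_smul {M N : ModuleCat.{0} R} (r : R) (g : M ⟶ N) {i : ℕ} (z : LC I i M) :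
    lmap I i (r • g) z = r • lmap I i g z := by
  unfold lmap; rw [Ext.mk₀_smul, lcomp_smul]

/-- functoriality for isomorphisms -/
noncomputable def lequiv (I : Ideal R) (i : ℕ) {M N : ModuleCat.{0} R} (e : M ≅ N) :
    LC I i M ≃ₗ[R] LC I i N :=
  LinearEquiv.ofLinearMap (lmap I i e.hom) (lmap I i e.inv)
    (by ext z; simp [lmap_lmap, lmap_id]) (by ext z; simp [lmap_lmap, lmap_id])

/-- connecting map -/
noncomputable def ldel (I : Ideal R) {S : ShortComplex (ModuleCat.{0} R)} (hS : S.ShortExact)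
    (i : ℕ) : LC I i S.X₃ →ₗ[R] LC I (i+1) S.X₁ := lcomp I hS.extClass rfl

section les
variable {S : ShortComplex (ModuleCat.{0} R)} {i : ℕ}

lemma lmap_f_g (x : LC I i S.X₁) : lmap I i S.g (lmap I i S.f x) = 0 := by
  rw [lmap_lmap, S.zero, lmap_zero]

lemma ldel_g (hS : S.ShortExact) (x : LC I i S.X₂) : ldel I hS i (lmap I i S.g x) = 0 := by
  unfold ldel lmap
  rw [lcomp_lcomp _ _ _ _ (zero_add 1), hS.comp_extClass, lcomp_zero]

lemma f_ldel (hS : S.ShortExact) (x : LC I i S.X₃) : lmap I (i+1) S.f (ldel I hS i x) = 0 := by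
  unfold ldel lmap
  rw [lcomp_lcomp _ _ _ _ (add_zero 1), hS.extClass_comp, lcomp_zero]

lemma les₂ (hS : S.ShortExact) (x : LC I i S.X₂) (hx : lmap I i S.g x = 0) : ∃ y, lmap I i S.f y = x := by
  obtain ⟨n, x, rfl⟩ := exists_lof x
  rw [lmap_lof] at hx
  obtain ⟨m, h, hm⟩ := lof_eq_zero hx
  rw [← lof_etr h] at hx ⊢
  have : ((Ext.mk₀ (qmap I h)).comp x (zero_add i)).comp (Ext.mk₀ S.g) (add_zero i) = 0 := by
    rw [Ext.comp_assoc _ _ _ (by omega) rfl (by omega), hm]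
  obtain ⟨y, hy⟩ := Ext.covariant_sequence_exact₂ _ hS _ this
  exact ⟨lof I i _ m y, by rw [lmap_lof, hy]⟩

lemma les₃ (hS : S.ShortExact) (x : LC I i S.X₃) (hx : ldel I hS i x = 0) : ∃ y, lmap I i S.g y = x := by
  obtain ⟨n, x, rfl⟩ := exists_lof x
  unfold ldel at hx
  rw [lcomp_lof] at hx
  obtain ⟨m, h, hm⟩ := lof_eq_zero hx
  rw [← lof_etr h] at hx ⊢
  have : ((Ext.mk₀ (qmap I h)).comp x (zero_add i)).comp hS.extClass rfl = 0 := by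
    rw [Ext.comp_assoc _ _ _ (by omega) rfl (by omega), hm]
  obtain ⟨y, hy⟩ := Ext.covariant_sequence_exact₃ _ hS _ _ this
  exact ⟨lof I i _ m y, by rw [lmap_lof, hy]⟩

lemma les₁ (hS : S.ShortExact) (x : LC I (i+1) S.X₁) (hx : lmap I (i+1) S.f x = 0) : ∃ y, ldel I hS i y = x := by
  obtain ⟨n, x, rfl⟩ := exists_lof x
  rw [lmap_lof] at hx
  obtain ⟨m, h, hm⟩ := lof_eq_zero hx
  rw [← lof_etr h] at hx ⊢
  have : ((Ext.mk₀ (qmap I h)).comp x (zero_add (i+1))).comp (Ext.mk₀ S.f) (add_zero (i+1)) = 0 := by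
    rw [Ext.comp_assoc _ _ _ (by omega) rfl (by omega), hm]
  obtain ⟨y, hy⟩ := Ext.covariant_sequence_exact₁ _ hS _ this rfl
  exact ⟨lof I i _ m y, by unfold ldel; rw [lcomp_lof, hy]⟩

lemma les₁_zero (hS : S.ShortExact) (x : LC I 0 S.X₁) (hx : lmap I 0 S.f x = 0) : x = 0 := by
  obtain ⟨n, x, rfl⟩ := exists_lof x
  rw [lmap_lof] at hx
  obtain ⟨m, h, hm⟩ := lof_eq_zero hx
  rw [← lof_etr h] at hx ⊢
  have : ((Ext.mk₀ (qmap I h)).comp x (zero_add 0)).comp (Ext.mk₀ S.f) (add_zero 0) = 0 := by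
    rw [Ext.comp_assoc _ _ _ (by omega) rfl (by omega), hm]
  obtain ⟨g, hg⟩ := (Ext.mk₀_bijective _ _).2 ((Ext.mk₀ (qmap I h)).comp x (zero_add 0))
  rw [← hg] at this ⊢
  rw [Ext.mk₀_comp_mk₀, Ext.mk₀_eq_zero_iff] at this
  have hm := hS.mono_f
  rw [Limits.zero_of_comp_mono S.f this, Ext.mk₀_zero, map_zero]

lemma lc_torsion {M : ModuleCat.{0} R} (x : LC I i M) : ∃ n, ∀ r ∈ I ^ n, r • x = 0 := by
  obtain ⟨n, x, rfl⟩ := exists_lof x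
  refine ⟨n, fun r hr => ?_⟩
  have : r • x = (Ext.mk₀ (r • 𝟙 (Qm I n))).comp x (zero_add i) := by simp [Ext.mk₀_smul]
  rw [← map_smul, this]
  have h0 : r • 𝟙 (Qm I n) = 0 := by
    apply ModuleCat.hom_ext
    apply LinearMap.ext
    intro y
    obtain ⟨y, rfl⟩ := Ideal.Quotient.mk_surjective y
    exact Ideal.Quotient.eq_zero_iff_mem.2 (Ideal.mul_mem_right y _ hr)
  rw [h0, Ext.mk₀_zero, Ext.zero_comp, map_zero]
end les

end RelCM

namespace RelCM
open Abelian localCohomology Limits Opposite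
variable {R : Type} [CommRing R]

/-- evaluated diagram -/
noncomputable abbrev dgm (I : Ideal R) (i : ℕ) (M : ModuleCat.{0} R) : ℕᵒᵖᵒᵖ ⥤ ModuleCat.{0} R :=
  diagram (idealPowersDiagram I) i ⋙ (evaluation _ _).obj M

noncomputable def lcIso1 (I : Ideal R) (i : ℕ) (M : ModuleCat.{0} R) :
    (localCohomology I i).obj M ≅ colimit (dgm I i M) :=
  colimitObjIsoColimitCompEvaluation (diagram (idealPowersDiagram I) i) M

/-- stage comparison -/
noncomputable def stg (I : Ideal R) (i : ℕ) (M : ModuleCat.{0} R) (n : ℕ) :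
    (dgm I i M).obj (op (op n)) ≃ₗ[R] Ext (Qm I n) M i := oldNew (Qm I n) M i

lemma stg_nat (I : Ideal R) (i : ℕ) (M : ModuleCat.{0} R) {m n : ℕ} (h : m ≤ n)
    (x : (dgm I i M).obj (op (op m))) :
    stg I i M n ((dgm I i M).map (homOfLE h).op.op x) = etr I M i m n h (stg I i M m x) :=
  oldNew_nat (qmap I h) M i x

/-- cocone -/
noncomputable def lcCocone (I : Ideal R) (i : ℕ) (M : ModuleCat.{0} R) : Cocone (dgm I i M) where
  pt := ModuleCat.of R (LC I i M)
  ι := { app := fun n => ModuleCat.ofHom ((lof I i M n.unop.unop).comp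
          (stg I i M n.unop.unop).toLinearMap)
         naturality := by
          intro m n f
          apply ModuleCat.hom_ext
          apply LinearMap.ext
          intro x
          have h : m.unop.unop ≤ n.unop.unop := leOfHom f.unop.unop
          have h2 := stg_nat I i M h x
          refine (congrArg (lof I i M n.unop.unop) h2).trans ?_
          exact lof_etr h _ }

noncomputable def lcFwd (I : Ideal R) (i : ℕ) (M : ModuleCat.{0} R) :
    colimit (dgm I i M) ⟶ ModuleCat.of R (LC I i M) := colimit.desc _ (lcCocone I i M)

noncomputable def lcBwd (I : Ideal R) (i : ℕ) (M : ModuleCat.{0} R) :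
    LC I i M →ₗ[R] (colimit (dgm I i M) : ModuleCat.{0} R) :=
  Module.DirectLimit.lift R ℕ _ (etr I M i)
    (fun n => (colimit.ι (dgm I i M) (op (op n))).hom.comp (stg I i M n).symm.toLinearMap) (by
      intro m n h x
      obtain ⟨x, rfl⟩ := (stg I i M m).surjective x
      rw [← stg_nat]
      simp only [LinearMap.comp_apply, LinearEquiv.coe_coe, LinearEquiv.symm_apply_apply]
      exact ConcreteCategory.congr_hom (colimit.w (dgm I i M) (homOfLE h).op.op) x)

lemma lcBwd_lof (I : Ideal R) (i : ℕ) (M : ModuleCat.{0} R) (n : ℕ) (x : Ext (Qm I n) M i) :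
    lcBwd I i M (lof I i M n x) = colimit.ι (dgm I i M) (op (op n)) ((stg I i M n).symm x) :=
  Module.DirectLimit.lift_of _ _ _

lemma lcFwd_ι (I : Ideal R) (i : ℕ) (M : ModuleCat.{0} R) (n : ℕ)
    (x : (dgm I i M).obj (op (op n))) :
    lcFwd I i M (colimit.ι (dgm I i M) (op (op n)) x) = lof I i M n (stg I i M n x) :=
  ConcreteCategory.congr_hom (colimit.ι_desc (lcCocone I i M) (op (op n))) x

lemma lcFwd_lcBwd (I : Ideal R) (i : ℕ) (M : ModuleCat.{0} R) (z : LC I i M) :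
    (lcFwd I i M).hom (lcBwd I i M z) = z := by
  obtain ⟨n, x, rfl⟩ := exists_lof z
  rw [lcBwd_lof]
  refine (lcFwd_ι I i M n _).trans ?_
  simp

lemma lcBwd_lcFwd (I : Ideal R) (i : ℕ) (M : ModuleCat.{0} R)
    (z : (colimit (dgm I i M) : ModuleCat.{0} R)) :
    lcBwd I i M ((lcFwd I i M).hom z) = z := by
  have : lcFwd I i M ≫ ModuleCat.ofHom (lcBwd I i M) = 𝟙 _ := by
    apply colimit.hom_ext
    intro j
    apply ModuleCat.hom_ext
    apply LinearMap.ext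
    intro x
    have h := lcFwd_ι I i M j.unop.unop x
    refine (congrArg (lcBwd I i M) h).trans ?_
    rw [lcBwd_lof, LinearEquiv.symm_apply_apply]
    rfl
  exact ConcreteCategory.congr_hom this z

/-- the bridge, categorical -/
noncomputable def lcIso2 (I : Ideal R) (i : ℕ) (M : ModuleCat.{0} R) :
    colimit (dgm I i M) ≅ ModuleCat.of R (LC I i M) where
  hom := lcFwd I i M
  inv := ModuleCat.ofHom (lcBwd I i M)
  hom_inv_id := by
    apply ModuleCat.hom_ext; apply LinearMap.ext; intro z
    exact lcBwd_lcFwd I i M z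
  inv_hom_id := by
    apply ModuleCat.hom_ext; apply LinearMap.ext; intro z
    exact lcFwd_lcBwd I i M z

/-- the bridge -/
noncomputable def lcBridge (I : Ideal R) (i : ℕ) (M : ModuleCat.{0} R) :
    (localCohomology I i).obj M ≅ ModuleCat.of R (LC I i M) :=
  lcIso1 I i M ≪≫ lcIso2 I i M

lemma lcBridge_nontrivial (I : Ideal R) (i : ℕ) (M : ModuleCat.{0} R) :
    Nontrivial ((localCohomology I i).obj M) ↔ Nontrivial (LC I i M) :=
  (lcBridge I i M).toLinearEquiv.toEquiv.nontrivial_congr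

/-- the bridge on duals -/
noncomputable def dualBridge (I : Ideal R) (i : ℕ) (M : ModuleCat.{0} R) (E : Type)
    [AddCommGroup E] [Module R E] :
    (LC I i M →ₗ[R] E) ≃ₗ[R] ((localCohomology I i).obj M →ₗ[R] E) where
  toFun φ := φ ∘ₗ (lcBridge I i M).hom.hom
  invFun φ := φ ∘ₗ (lcBridge I i M).inv.hom
  map_add' φ ψ := rfl
  map_smul' r φ := rfl
  left_inv φ := by
    apply LinearMap.ext; intro z
    exact congrArg φ (ConcreteCategory.congr_hom (lcBridge I i M).inv_hom_id z)
  right_inv φ := by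
    apply LinearMap.ext; intro z
    exact congrArg φ (ConcreteCategory.congr_hom (lcBridge I i M).hom_inv_id z)

end RelCM

namespace RelCM
open Abelian
variable {R : Type} [CommRing R]

/-- torsion -/
def Tors (I : Ideal R) (N : Type) [AddCommGroup N] [Module R N] : Prop :=
  ∀ x : N, ∃ n, ∀ r ∈ I ^ n, r • x = 0

/-- torsion submodule -/
def gam (I : Ideal R) (J : Type) [AddCommGroup J] [Module R J] : Submodule R J where
  carrier := {x | ∃ n, ∀ r ∈ I ^ n, r • x = 0}
  zero_mem' := ⟨0, fun r _ => smul_zero r⟩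
  add_mem' := by
    rintro x y ⟨n, hn⟩ ⟨m, hm⟩
    refine ⟨n + m, fun r hr => ?_⟩
    rw [smul_add, hn r (Ideal.pow_le_pow_right (by omega) hr),
      hm r (Ideal.pow_le_pow_right (by omega) hr), add_zero]
  smul_mem' := by
    rintro s x ⟨n, hn⟩
    refine ⟨n, fun r hr => ?_⟩
    rw [smul_comm, hn r hr, smul_zero]

lemma gam_tors (I : Ideal R) (J : Type) [AddCommGroup J] [Module R J] : Tors I (gam I J) := by
  rintro ⟨x, n, hn⟩
  exact ⟨n, fun r hr => Subtype.ext (hn r hr)⟩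

lemma Tors.map {I : Ideal R} {M N : Type} [AddCommGroup M] [Module R M] [AddCommGroup N]
    [Module R N] (h : Tors I M) (g : M →ₗ[R] N) (hg : Function.Surjective g) : Tors I N := by
  intro y
  obtain ⟨x, rfl⟩ := hg y
  obtain ⟨n, hn⟩ := h x
  exact ⟨n, fun r hr => by rw [← map_smul, hn r hr, map_zero]⟩

lemma tors_fg {I : Ideal R} {N : Type} [AddCommGroup N] [Module R N] (S : Finset N)
    (h : Tors I N) : ∃ n, ∀ r ∈ I ^ n, ∀ x ∈ Submodule.span R (S : Set N), r • x = 0 := by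
  choose n hn using h
  refine ⟨S.sup n, fun r hr x hx => ?_⟩
  induction hx using Submodule.span_induction with
  | mem x hx => exact hn x r (Ideal.pow_le_pow_right (Finset.le_sup hx) hr)
  | zero => simp
  | add x y _ _ hx hy => rw [smul_add, hx, hy, add_zero]
  | smul a x _ hx => rw [smul_comm, hx, smul_zero]

lemma gam_injective [IsNoetherianRing R] (I : Ideal R) (J : Type) [AddCommGroup J] [Module R J]
    [hJ : Module.Injective R J] : Module.Injective R (gam I J) := by
  apply Module.Baer.injective
  intro L f
  -- f kills I^k L
  obtain ⟨k, hk⟩ : ∃ k, ∀ r ∈ I ^ k, ∀ x : L, r • f x = 0 := by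
    obtain ⟨S, hS⟩ := (inferInstance : Module.Finite R (LinearMap.range f)).fg_top
    have ht : Tors I (LinearMap.range f) := by
      rintro ⟨y, hy⟩
      obtain ⟨n, hn⟩ := gam_tors I J y
      exact ⟨n, fun r hr => Subtype.ext (hn r hr)⟩
    obtain ⟨n, hn⟩ := tors_fg S ht
    refine ⟨n, fun r hr x => ?_⟩
    have := hn r hr ⟨f x, x, rfl⟩ (by rw [hS]; trivial)
    exact congrArg Subtype.val this
  obtain ⟨k0, hAR⟩ := Ideal.exists_pow_inf_eq_pow_smul I L
  have hAR := hAR (k + k0) (by omega)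
  rw [Nat.add_sub_cancel] at hAR
  set n := k + k0
  have hle : I ^ n ⊓ L ≤ I ^ k * L := by
    have h1 : I ^ n • (⊤ : Submodule R R) ⊓ L = I ^ n ⊓ L := by simp
    rw [← h1, hAR]
    exact Submodule.smul_mono le_rfl inf_le_right
  have hker : Submodule.comap L.subtype (I ^ n) ≤ LinearMap.ker ((gam I J).subtype ∘ₗ f) := by
    intro x hx
    have hx' : (x : R) ∈ I ^ k * L := hle ⟨hx, x.2⟩
    have key : ∀ y ∈ I ^ k * L, ∀ hy : y ∈ L, f ⟨y, hy⟩ = 0 := by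
      intro y hy
      refine Submodule.mul_induction_on' (C := fun y _ => ∀ hy : y ∈ L, f ⟨y, hy⟩ = 0) ?_ ?_ hy
      · intro a ha b hb hab
        have : (⟨a * b, hab⟩ : L) = a • ⟨b, hb⟩ := rfl
        rw [this, map_smul, hk a ha]
      · intro a ha b hb h1 h2 hab
        have ha' : a ∈ L := (show I ^ k * L ≤ L from Ideal.mul_le_right) ha
        have hb' : b ∈ L := (show I ^ k * L ≤ L from Ideal.mul_le_right) hb
        have : (⟨a + b, hab⟩ : L) = ⟨a, ha'⟩ + ⟨b, hb'⟩ := rfl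
        rw [this, map_add, h1, h2, add_zero]
    rw [LinearMap.mem_ker, LinearMap.comp_apply, key x hx' x.2, map_zero]
  obtain ⟨h, hh⟩ := hJ.out (Submodule.mapQ (Submodule.comap L.subtype (I ^ n)) (I ^ n) L.subtype le_rfl)
    (by
      rw [← LinearMap.ker_eq_bot, Submodule.ker_mapQ, Submodule.mkQ_map_self])
    (Submodule.liftQ _ _ hker)
  refine ⟨LinearMap.codRestrict (gam I J) (h ∘ₗ (I ^ n).mkQ) ?_, ?_⟩
  · intro c
    refine ⟨n, fun r hr => ?_⟩
    rw [← map_smul]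
    have : r • c ∈ I ^ n := Ideal.mul_mem_right _ _ hr
    rw [LinearMap.comp_apply, Submodule.mkQ_apply, (Submodule.Quotient.mk_eq_zero _).2 this, map_zero]
  · intro x hx
    apply Subtype.ext
    exact hh (Submodule.Quotient.mk ⟨x, hx⟩)

/-- evaluation at one -/
noncomputable def evn (I : Ideal R) (M : ModuleCat.{0} R) (n : ℕ) : Ext (Qm I n) M 0 →ₗ[R] M :=
  (LinearMap.applyₗ (Ideal.Quotient.mk (I ^ n) 1)) ∘ₗ
    (ModuleCat.homLinearEquiv (S := R)).toLinearMap ∘ₗ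
    (Ext.linearEquiv₀ (R := R) (X := Qm I n) (Y := M)).toLinearMap

lemma evn_mk₀ (I : Ideal R) (M : ModuleCat.{0} R) (n : ℕ) (g : Qm I n ⟶ M) :
    evn I M n (Ext.mk₀ g) = g (Ideal.Quotient.mk (I ^ n) 1) := by
  have : (Ext.linearEquiv₀ (R := R) (X := Qm I n) (Y := M)) (Ext.mk₀ g) = g := by
    apply (Ext.linearEquiv₀ (R := R) (X := Qm I n) (Y := M)).symm.injective
    rw [LinearEquiv.symm_apply_apply]; rfl
  exact ConcreteCategory.congr_hom this (Ideal.Quotient.mk (I ^ n) 1)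

lemma evn_inj (I : Ideal R) (M : ModuleCat.{0} R) (n : ℕ) (x) (hx : evn I M n x = 0) : x = 0 := by
  obtain ⟨g, rfl⟩ := (Ext.mk₀_bijective _ _).2 x
  rw [evn_mk₀] at hx
  rw [Ext.mk₀_eq_zero_iff]
  apply ModuleCat.hom_ext; apply LinearMap.ext; intro y
  obtain ⟨y, rfl⟩ := Ideal.Quotient.mk_surjective y
  have : (Ideal.Quotient.mk (I ^ n) y) = y • Ideal.Quotient.mk (I ^ n) 1 := by
    rw [← Ideal.Quotient.mk_eq_mk, ← Ideal.Quotient.mk_eq_mk, ← Submodule.Quotient.mk_smul]; simp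
  rw [this]
  refine (map_smul g.hom y _).trans ?_
  exact (congrArg (y • ·) hx).trans (smul_zero y)

lemma evn_surj (I : Ideal R) (M : ModuleCat.{0} R) (n : ℕ) (t : M) (ht : ∀ r ∈ I ^ n, r • t = 0) :
    ∃ x, evn I M n x = t := by
  refine ⟨Ext.mk₀ (ModuleCat.ofHom (Submodule.liftQ (I ^ n) (LinearMap.toSpanSingleton R M t)
    (fun r hr => ht r hr))), ?_⟩
  rw [evn_mk₀]
  exact one_smul R t

lemma evn_comp (I : Ideal R) {M N : ModuleCat.{0} R} (g : M ⟶ N) (n : ℕ) (x : Ext (Qm I n) M 0) :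
    evn I N n (x.comp (Ext.mk₀ g) (add_zero 0)) = g (evn I M n x) := by
  obtain ⟨x, rfl⟩ := (Ext.mk₀_bijective _ _).2 x
  rw [Ext.mk₀_comp_mk₀, evn_mk₀, evn_mk₀]
  rfl

/-- evaluation -/
noncomputable def ev (I : Ideal R) (M : ModuleCat.{0} R) : LC I 0 M →ₗ[R] M :=
  Module.DirectLimit.lift R ℕ _ (etr I M 0) (fun n => evn I M n) (by
    intro i j h x
    obtain ⟨x, rfl⟩ := (Ext.mk₀_bijective _ _).2 x
    rw [etr_apply, Ext.mk₀_comp_mk₀, evn_mk₀, evn_mk₀]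
    rfl)

lemma ev_lof (I : Ideal R) (M : ModuleCat.{0} R) (n : ℕ) (x) :
    ev I M (lof I 0 M n x) = evn I M n x := Module.DirectLimit.lift_of _ _ _

lemma ev_inj (I : Ideal R) (M : ModuleCat.{0} R) : Function.Injective (ev I M) := by
  rw [injective_iff_map_eq_zero]
  intro z hz
  obtain ⟨n, x, rfl⟩ := exists_lof z
  rw [ev_lof] at hz
  rw [evn_inj _ _ _ _ hz, map_zero]

lemma ev_surj (I : Ideal R) (M : ModuleCat.{0} R) (h : Tors I M) : Function.Surjective (ev I M) := by
  intro t
  obtain ⟨n, hn⟩ := h t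
  obtain ⟨x, hx⟩ := evn_surj I M n t hn
  exact ⟨lof I 0 M n x, by rw [ev_lof, hx]⟩

lemma ev_nat (I : Ideal R) {M N : ModuleCat.{0} R} (g : M ⟶ N) (z : LC I 0 M) :
    ev I N (lmap I 0 g z) = g (ev I M z) := by
  obtain ⟨n, x, rfl⟩ := exists_lof z
  rw [lmap_lof, ev_lof, ev_lof, evn_comp]

lemma lc_injective (I : Ideal R) (M : ModuleCat.{0} R) [CategoryTheory.Injective M] (i : ℕ)
    (z : LC I (i+1) M) : z = 0 := by
  obtain ⟨n, x, rfl⟩ := exists_lof z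
  rw [Ext.eq_zero_of_injective x, map_zero]

section
variable {I : Ideal R} {i : ℕ} {X Y Z : ModuleCat.{0} R} {f : X ⟶ Y} {g : Y ⟶ Z} (w : f ≫ g = 0)

/-- connecting map -/
noncomputable def ldel' (I : Ideal R) {X Y Z : ModuleCat.{0} R} {f : X ⟶ Y} {g : Y ⟶ Z} (w : f ≫ g = 0)
    (h : (ShortComplex.mk f g w).ShortExact)
    (i : ℕ) : LC I i Z →ₗ[R] LC I (i+1) X := ldel I h i

lemma les₂' (h : (ShortComplex.mk f g w).ShortExact)
    (x : LC I i Y) (hx : lmap I i g x = 0) : ∃ y, lmap I i f y = x := by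
  have := les₂ h x
  dsimp only at this
  exact this hx

lemma les₃' (h : (ShortComplex.mk f g w).ShortExact)
    (x : LC I i Z) (hx : ldel' I w h i x = 0) : ∃ y, lmap I i g y = x := by
  have := les₃ h x
  dsimp only at this
  exact this hx

lemma les₁' (h : (ShortComplex.mk f g w).ShortExact)
    (x : LC I (i+1) X) (hx : lmap I (i+1) f x = 0) : ∃ y, ldel' I w h i y = x := by
  have := les₁ h x
  dsimp only at this
  exact this hx

lemma les₁_zero' (h : (ShortComplex.mk f g w).ShortExact)
    (x : LC I 0 X) (hx : lmap I 0 f x = 0) : x = 0 := by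
  have := les₁_zero h x
  dsimp only at this
  exact this hx

lemma ldel_g' (h : (ShortComplex.mk f g w).ShortExact)
    (x : LC I i Y) : ldel' I w h i (lmap I i g x) = 0 := by
  have := ldel_g h x
  dsimp only at this
  exact this

lemma f_ldel' (h : (ShortComplex.mk f g w).ShortExact)
    (x : LC I i Z) : lmap I (i+1) f (ldel' I w h i x) = 0 := by
  have := f_ldel h x
  dsimp only at this
  exact this

end

/-- unbundled short exact sequences -/
structure SES {A B C : Type} [AddCommGroup A] [Module R A] [AddCommGroup B] [Module R B]
    [AddCommGroup C] [Module R C] (f : A →ₗ[R] B) (g : B →ₗ[R] C) : Prop where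
  inj : Function.Injective f
  exact : Function.Exact f g
  surj : Function.Surjective g

section
variable {A B C : Type} [AddCommGroup A] [Module R A] [AddCommGroup B] [Module R B]
    [AddCommGroup C] [Module R C] {f : A →ₗ[R] B} {g : B →ₗ[R] C}

/-- bundled version -/
noncomputable abbrev SES.sc (h : SES f g) : ShortComplex (ModuleCat.{0} R) :=
  ShortComplex.mk (ModuleCat.ofHom f) (ModuleCat.ofHom g) (by
    apply ModuleCat.hom_ext; apply LinearMap.ext; intro x
    exact h.exact.apply_apply_eq_zero x)

lemma SES.se (h : SES f g) : h.sc.ShortExact where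
  exact := by
    rw [ShortComplex.moduleCat_exact_iff]
    intro x hx
    exact (h.exact x).1 hx
  mono_f := (ModuleCat.mono_iff_injective _).2 h.inj
  epi_g := (ModuleCat.epi_iff_surjective _).2 h.surj

lemma ses_mkQ (N : Submodule R A) : SES N.subtype N.mkQ where
  inj := N.subtype_injective
  exact := LinearMap.exact_subtype_mkQ N
  surj := N.mkQ_surjective

lemma ses_range (hf : Function.Injective f) : SES f (LinearMap.range f).mkQ where
  inj := hf
  exact := LinearMap.exact_map_mkQ_range f
  surj := Submodule.mkQ_surjective _

lemma ses_ker (hg : Function.Surjective g) : SES (LinearMap.ker g).subtype g where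
  inj := Submodule.subtype_injective _
  exact := LinearMap.exact_subtype_ker_map g
  surj := hg

/-- unbundled local cohomology -/
abbrev H (I : Ideal R) (i : ℕ) (M : Type) [AddCommGroup M] [Module R M] : Type :=
  LC I i (ModuleCat.of R M)

/-- functoriality -/
noncomputable abbrev Hm (I : Ideal R) (i : ℕ) (f : A →ₗ[R] B) : H I i A →ₗ[R] H I i B :=
  lmap I i (ModuleCat.ofHom f)

/-- connecting map -/
noncomputable def Hd (I : Ideal R) (i : ℕ) (h : SES f g) : H I i C →ₗ[R] H I (i+1) A :=
  ldel' I _ h.se i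

variable (I : Ideal R) (i : ℕ)

lemma Hm_comp (f : A →ₗ[R] B) (g : B →ₗ[R] C) : Hm I i (g ∘ₗ f) = Hm I i g ∘ₗ Hm I i f := by
  apply LinearMap.ext; intro z
  exact (lmap_lmap (ModuleCat.ofHom f) (ModuleCat.ofHom g) z).symm

lemma Hm_id : Hm I i (LinearMap.id : A →ₗ[R] A) = LinearMap.id := by
  apply LinearMap.ext; intro z
  exact lmap_id z

lemma Hm_add (f g : A →ₗ[R] B) : Hm I i (f + g) = Hm I i f + Hm I i g := by
  apply LinearMap.ext; intro z
  exact lmap_add (ModuleCat.ofHom f) (ModuleCat.ofHom g) z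

lemma Hm_smul (r : R) (f : A →ₗ[R] B) : Hm I i (r • f) = r • Hm I i f := by
  apply LinearMap.ext; intro z
  exact lmap_smul r (ModuleCat.ofHom f) z

lemma Hm_zero : Hm I i (0 : A →ₗ[R] B) = 0 := by
  apply LinearMap.ext; intro z
  exact lmap_zero z

lemma Hm_f_g (h : SES f g) (y : H I i A) : Hm I i g (Hm I i f y) = 0 := by
  rw [← LinearMap.comp_apply, ← Hm_comp, h.exact.linearMap_comp_eq_zero, Hm_zero,
    LinearMap.zero_apply]

lemma Hd_g (h : SES f g) (y : H I i B) : Hd I i h (Hm I i g y) = 0 :=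
  ldel_g' _ h.se y

lemma H_ex₂ (h : SES f g) (z : H I i B) (hz : Hm I i g z = 0) : ∃ y, Hm I i f y = z :=
  les₂' _ h.se z hz

lemma H_ex₃ (h : SES f g) (z : H I i C) (hz : Hd I i h z = 0) : ∃ y, Hm I i g y = z :=
  les₃' _ h.se z hz

lemma H_exact₂ (h : SES f g) : Function.Exact (Hm I i f) (Hm I i g) := by
  intro z
  constructor
  · exact H_ex₂ I i h z
  · rintro ⟨y, rfl⟩
    exact Hm_f_g I i h y

lemma H_exact₃ (h : SES f g) : Function.Exact (Hm I i g) (Hd I i h) := by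
  intro z
  constructor
  · exact H_ex₃ I i h z
  · rintro ⟨y, rfl⟩
    exact Hd_g I i h y

lemma H_exact₁ (h : SES f g) : Function.Exact (Hd I i h) (Hm I (i+1) f) := by
  intro z
  exact ⟨fun hz => les₁' _ h.se z hz, by rintro ⟨y, rfl⟩; exact f_ldel' _ h.se y⟩

lemma H_inj₀ (h : SES f g) : Function.Injective (Hm I 0 f) := by
  rw [injective_iff_map_eq_zero]
  exact fun z hz => les₁_zero' _ h.se z hz

/-- isomorphism invariance -/
noncomputable def He (e : A ≃ₗ[R] B) : H I i A ≃ₗ[R] H I i B := lequiv I i e.toModuleIso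

lemma H_of_equiv (e : A ≃ₗ[R] B) (hB : Subsingleton (H I i B)) : Subsingleton (H I i A) :=
  (He I i e).toEquiv.subsingleton

lemma H_mid (h : SES f g) (hA : Subsingleton (H I i A)) (hC : Subsingleton (H I i C)) :
    Subsingleton (H I i B) := by
  refine subsingleton_of_forall_eq 0 fun z => ?_
  obtain ⟨y, rfl⟩ := (H_exact₂ I i h z).1 (Subsingleton.elim _ _)
  rw [Subsingleton.elim y 0, map_zero]

lemma H_left (h : SES f g) (hB : Subsingleton (H I (i+1) B)) (hC : Subsingleton (H I i C)) :
    Subsingleton (H I (i+1) A) := by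
  refine subsingleton_of_forall_eq 0 fun z => ?_
  obtain ⟨y, rfl⟩ := (H_exact₁ I i h z).1 (Subsingleton.elim _ _)
  rw [Subsingleton.elim y 0, map_zero]

lemma H_right (h : SES f g) (hB : Subsingleton (H I i B)) (hA : Subsingleton (H I (i+1) A)) :
    Subsingleton (H I i C) := by
  refine subsingleton_of_forall_eq 0 fun z => ?_
  obtain ⟨y, rfl⟩ := (H_exact₃ I i h z).1 (Subsingleton.elim _ _)
  rw [Subsingleton.elim y 0, map_zero]

end

lemma exists_tors_ses [IsNoetherianRing R] (I : Ideal R) (N : Type) [AddCommGroup N] [Module R N]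
    (h : Tors I N) : ∃ (T : Type) (_ : AddCommGroup T) (_ : Module R T) (f : N →ₗ[R] T),
      Function.Injective f ∧ Tors I T ∧ Module.Injective R T := by
  let J : ModuleCat.{0} R := Injective.under (ModuleCat.of R N)
  let g : N →ₗ[R] J := (Injective.ι (ModuleCat.of R N)).hom
  have hg : Function.Injective g := (ModuleCat.mono_iff_injective (Injective.ι (ModuleCat.of R N))).1
    inferInstance
  have : Module.Injective R J := by
    have : CategoryTheory.Injective (ModuleCat.of R J) := inferInstanceAs (CategoryTheory.Injective J)
    exact Module.injective_module_of_injective_object R J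
  refine ⟨gam I J, inferInstance, inferInstance, g.codRestrict (gam I J) ?_, ?_, gam_tors I J,
    gam_injective I J⟩
  · intro x
    obtain ⟨n, hn⟩ := h x
    exact ⟨n, fun r hr => by rw [← map_smul, hn r hr, map_zero]⟩
  · intro x y hxy
    exact hg (congrArg Subtype.val hxy)

lemma lc_tors [IsNoetherianRing R] (I : Ideal R) (i : ℕ) : ∀ (N : Type) [AddCommGroup N] [Module R N],
    Tors I N → Subsingleton (H I (i+1) N) := by
  induction i with
  | zero =>
    intro N _ _ h
    refine subsingleton_of_forall_eq 0 fun z => ?_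
    obtain ⟨T, _, _, f, hf, hT, hTi⟩ := exists_tors_ses I N h
    have hS := ses_range hf
    have : CategoryTheory.Injective (ModuleCat.of R T) :=
      Module.injective_object_of_injective_module R T
    obtain ⟨y, rfl⟩ := (H_exact₁ I 0 hS z).1 (lc_injective I (ModuleCat.of R T) 0 _)
    obtain ⟨t, ht⟩ := hS.surj (ev I _ y)
    obtain ⟨w, rfl⟩ := ev_surj I (ModuleCat.of R T) hT t
    have : y = Hm I 0 (LinearMap.range f).mkQ w := by
      apply ev_inj
      rw [ev_nat]
      exact ht.symm
    rw [this, (H_exact₃ I 0 hS).apply_apply_eq_zero]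
  | succ i ih =>
    intro N _ _ h
    obtain ⟨T, _, _, f, hf, hT, hTi⟩ := exists_tors_ses I N h
    have hS := ses_range hf
    have : CategoryTheory.Injective (ModuleCat.of R T) :=
      Module.injective_object_of_injective_module R T
    exact H_left I _ hS (subsingleton_of_forall_eq 0 (lc_injective I (ModuleCat.of R T) _))
      (ih _ (hT.map _ hS.surj))

end RelCM

namespace RelCM
open Abelian
variable {R : Type} [CommRing R]

/-- L kills N -/
def Kills (L : Ideal R) (N : Type) [AddCommGroup N] [Module R N] : Prop :=
  ∀ r ∈ L, ∀ x : N, r • x = 0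

lemma Kills.sub {L : Ideal R} {N : Type} [AddCommGroup N] [Module R N] (h : Kills L N)
    (P : Submodule R N) : Kills L P := fun r hr x => Subtype.ext (h r hr x)

lemma Kills.quot {L : Ideal R} {N : Type} [AddCommGroup N] [Module R N] (h : Kills L N)
    (P : Submodule R N) : Kills L (N ⧸ P) := by
  intro r hr x
  obtain ⟨x, rfl⟩ := P.mkQ_surjective x
  rw [← map_smul, h r hr, map_zero]

lemma Kills.sup_span {L : Ideal R} {N : Type} [AddCommGroup N] [Module R N] (h : Kills L N)
    (x : R) (hx : ∀ y : N, x • y = 0) : Kills (L ⊔ Ideal.span {x}) N := by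
  intro r hr y
  obtain ⟨a, ha, b, hb, rfl⟩ := Submodule.mem_sup.1 hr
  obtain ⟨c, rfl⟩ := Ideal.mem_span_singleton'.1 hb
  rw [add_smul, h a ha, mul_smul, hx, smul_zero, add_zero]

/-- uniform vanishing -/
def Bd (I L : Ideal R) (n : ℕ) : Prop :=
  ∀ (N : Type) [AddCommGroup N] [Module R N] [Module.Finite R N], Kills L N →
    ∀ i, n ≤ i → Subsingleton (H I i N)

lemma bd_pow [IsNoetherianRing R] {I L : Ideal R} {n : ℕ} {x : R} (h : Bd I (L ⊔ Ideal.span {x}) n)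
    (k : ℕ) : ∀ (N : Type) [AddCommGroup N] [Module R N] [Module.Finite R N], Kills L N →
      (∀ y : N, x ^ k • y = 0) → ∀ i, n ≤ i → Subsingleton (H I i N) := by
  induction k with
  | zero =>
    intro N _ _ _ hL hx i hi
    refine h N (hL.sup_span x fun y => ?_) i hi
    have := hx y
    rw [pow_zero, one_smul] at this
    rw [this, smul_zero]
  | succ k ih =>
    intro N _ _ _ hL hx i hi
    let m : N →ₗ[R] N := LinearMap.lsmul R N x
    have hS := ses_ker (LinearMap.surjective_rangeRestrict m)
    refine H_mid I i hS (h _ ((hL.sub _).sup_span x ?_) i hi) (ih _ (hL.sub _) ?_ i hi)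
    · rintro ⟨y, hy⟩
      have h2 : m.rangeRestrict y = 0 := hy
      have h3 : m y = 0 := congrArg Subtype.val h2
      exact Subtype.ext h3
    · rintro ⟨_, y, rfl⟩
      apply Subtype.ext
      change x ^ k • (x • y) = 0
      rw [smul_smul, ← pow_succ, hx]

lemma bd_reg [IsNoetherianRing R] {I L : Ideal R} {n : ℕ} {x : R} (hxI : x ∈ I)
    (h : Bd I (L ⊔ Ideal.span {x}) n) (N : Type) [AddCommGroup N] [Module R N] [Module.Finite R N]
    (hL : Kills L N) (hx : ∀ y : N, x • y = 0 → y = 0) (i : ℕ) (hi : n ≤ i) :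
    Subsingleton (H I (i+1) N) := by
  let m : N →ₗ[R] N := x • LinearMap.id
  have hm : Function.Injective m := by
    rw [injective_iff_map_eq_zero]
    exact hx
  have hS := ses_range hm
  have hq : Subsingleton (H I i (N ⧸ LinearMap.range m)) := by
    refine h _ ((hL.quot _).sup_span x ?_) i hi
    intro y
    obtain ⟨y, rfl⟩ := Submodule.mkQ_surjective _ y
    rw [← map_smul]
    exact (Submodule.Quotient.mk_eq_zero _).2 ⟨y, rfl⟩
  have hinj : ∀ z : H I (i+1) N, x • z = 0 → z = 0 := by
    intro z hz
    have : Hm I (i+1) m z = 0 := by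
      rw [Hm_smul, Hm_id]
      exact hz
    obtain ⟨y, rfl⟩ := (H_exact₁ I i hS z).1 this
    rw [Subsingleton.elim y 0, map_zero]
  have hpow : ∀ k, ∀ z : H I (i+1) N, x ^ k • z = 0 → z = 0 := by
    intro k
    induction k with
    | zero => intro z hz; simpa using hz
    | succ k ih =>
      intro z hz
      rw [pow_succ, mul_smul] at hz
      exact hinj z (ih _ hz)
  refine subsingleton_of_forall_eq 0 fun z => ?_
  obtain ⟨k, hk⟩ := lc_torsion z
  exact hpow k z (hk _ (Ideal.pow_mem_pow hxI k))

lemma exists_bd [IsNoetherianRing R] (I L : Ideal R) : ∃ n, Bd I L n := by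
  refine IsNoetherian.induction (P := fun L => ∃ n, Bd I L n) ?_ L
  intro L ih
  by_cases hIL : I ≤ L
  · refine ⟨1, fun N _ _ _ hN i hi => ?_⟩
    obtain ⟨i, rfl⟩ : ∃ j, i = j + 1 := ⟨i - 1, by omega⟩
    refine lc_tors I i N fun x => ⟨1, fun r hr => hN r (hIL (by simpa using hr)) x⟩
  · obtain ⟨x, hxI, hxL⟩ := SetLike.not_le_iff_exists.1 hIL
    obtain ⟨n, hn⟩ := ih (L ⊔ Ideal.span {x}) (lt_of_le_of_ne le_sup_left (by
      intro h
      apply hxL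
      rw [h]
      exact Ideal.mem_sup_right (Ideal.mem_span_singleton_self x)))
    refine ⟨n + 1, fun N _ _ _ hN i hi => ?_⟩
    obtain ⟨i, rfl⟩ : ∃ j, i = j + 1 := ⟨i - 1, by omega⟩
    have hS := ses_mkQ (gam (Ideal.span {x}) N)
    refine H_mid I _ hS ?_ (bd_reg hxI hn _ (hN.quot _) ?_ i (by omega))
    · obtain ⟨S, hS⟩ := (inferInstance : Module.Finite R (gam (Ideal.span {x}) N)).fg_top
      obtain ⟨k, hk⟩ := tors_fg S (gam_tors (Ideal.span {x}) N)
      refine bd_pow hn k _ (hN.sub _) (fun y => hk _ ?_ y (by rw [hS]; trivial)) _ (by omega)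
      exact Ideal.pow_mem_pow (Ideal.mem_span_singleton_self x) k
    · intro y hy
      obtain ⟨y, rfl⟩ := Submodule.mkQ_surjective _ y
      rw [← map_smul] at hy
      obtain ⟨m, hm⟩ := (Submodule.Quotient.mk_eq_zero _).1 hy
      refine (Submodule.Quotient.mk_eq_zero _).2 ⟨m + 1, fun r hr => ?_⟩
      rw [Ideal.span_singleton_pow] at hr hm
      obtain ⟨s, rfl⟩ := Ideal.mem_span_singleton'.1 hr
      have := hm (s * x ^ m) (Ideal.mem_span_singleton'.2 ⟨s, rfl⟩)
      rwa [smul_smul, mul_assoc, ← pow_succ] at this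

section free
variable (I : Ideal R) (i : ℕ)

lemma Hm_sum {A B ι : Type} [AddCommGroup A] [Module R A] [AddCommGroup B] [Module R B]
    (s : Finset ι) (f : ι → (A →ₗ[R] B)) : Hm I i (∑ j ∈ s, f j) = ∑ j ∈ s, Hm I i (f j) := by
  classical
  induction s using Finset.induction_on with
  | empty => simp only [Finset.sum_empty, Hm_zero]
  | insert a s ha ih => rw [Finset.sum_insert ha, Finset.sum_insert ha, Hm_add, ih]

/-- coordinate inclusion -/
abbrev inc {k : ℕ} (j : Fin k) : R →ₗ[R] (Fin k → R) := LinearMap.single R (fun _ => R) j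

/-- coordinate projection -/
abbrev prj {k : ℕ} (j : Fin k) : (Fin k → R) →ₗ[R] R := LinearMap.proj j

lemma sum_inc_prj (k : ℕ) :
    (∑ j : Fin k, (inc j) ∘ₗ (prj j)) = (LinearMap.id : (Fin k → R) →ₗ[R] (Fin k → R)) := by
  apply LinearMap.ext; intro v
  simp only [LinearMap.sum_apply, LinearMap.comp_apply, LinearMap.id_apply]
  exact Finset.univ_sum_single v

lemma H_free_decomp (k : ℕ) (z : H I i (Fin k → R)) :
    z = ∑ j : Fin k, Hm I i (inc j) (Hm I i (prj j) z) := by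
  conv_lhs => rw [← LinearMap.id_apply (R := R) z, ← Hm_id, ← sum_inc_prj, Hm_sum]
  simp only [LinearMap.sum_apply, Hm_comp, LinearMap.comp_apply]

lemma H_free (k : ℕ) (h : Subsingleton (H I i R)) : Subsingleton (H I i (Fin k → R)) := by
  refine subsingleton_of_forall_eq 0 fun z => ?_
  rw [H_free_decomp I i k z]
  refine Finset.sum_eq_zero fun j _ => ?_
  rw [Subsingleton.elim (Hm I i (prj j) z) 0, map_zero]

end free

lemma H_top [IsNoetherianRing R] (I : Ideal R) (c : ℕ) (h : ∀ i, i ≠ c → Subsingleton (H I i R))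
    (N : Type) [AddCommGroup N] [Module R N] [Module.Finite R N] (i : ℕ) (hi : c < i) :
    Subsingleton (H I i N) := by
  obtain ⟨n, hn⟩ := exists_bd I ⊥
  have key : ∀ d, ∀ (N : Type) [AddCommGroup N] [Module R N] [Module.Finite R N] (i : ℕ), c < i →
      n ≤ i + d → Subsingleton (H I i N) := by
    intro d
    induction d with
    | zero =>
      intro N _ _ _ i hi hd
      exact hn N (fun r hr x => by rw [(Submodule.mem_bot R).1 hr, zero_smul]) i hd
    | succ d ih =>
      intro N _ _ _ i hi hd
      obtain ⟨k, g, hg⟩ := Module.Finite.exists_fin' R N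
      exact H_right I i (ses_ker hg) (H_free I i k (h i (by omega))) (ih _ (i+1) (by omega) (by omega))
  exact key n N i hi (by omega)

end RelCM

namespace RelCM
open Abelian
variable {R : Type} [CommRing R]

section bundled
variable {X Y Z : ModuleCat.{0} R} {f : X ⟶ Y} {g : Y ⟶ Z} (w : f ≫ g = 0)

lemma cex₁ (h : (ShortComplex.mk f g w).ShortExact) {K : ModuleCat.{0} R} {j j' : ℕ} (hj : 1 + j = j')
    (x : Ext X K j) (hx : h.extClass.comp x hj = 0) : ∃ y : Ext Y K j, (Ext.mk₀ f).comp y (zero_add j) = x := by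
  have := Ext.contravariant_sequence_exact₁ h _ x hj
  dsimp only at this
  exact this hx

lemma cex₂ (h : (ShortComplex.mk f g w).ShortExact) {K : ModuleCat.{0} R} {j : ℕ}
    (x : Ext Y K j) (hx : (Ext.mk₀ f).comp x (zero_add j) = 0) :
    ∃ y : Ext Z K j, (Ext.mk₀ g).comp y (zero_add j) = x := by
  have := Ext.contravariant_sequence_exact₂ h _ x
  dsimp only at this
  exact this hx

lemma cex₃ (h : (ShortComplex.mk f g w).ShortExact) {K : ModuleCat.{0} R} {j j' : ℕ} (hj : 1 + j = j')
    (x : Ext Z K j') (hx : (Ext.mk₀ g).comp x (zero_add j') = 0) :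
    ∃ y : Ext X K j, h.extClass.comp y hj = x := by
  have := Ext.contravariant_sequence_exact₃ h _ x (hn₀ := hj)
  dsimp only at this
  exact this hx

lemma c_fd (h : (ShortComplex.mk f g w).ShortExact) {K : ModuleCat.{0} R} {j j' : ℕ} (hj : 1 + j = j')
    (y : Ext Y K j) : h.extClass.comp ((Ext.mk₀ f).comp y (zero_add j)) hj = 0 := by
  have := h.extClass_comp_assoc y (h := hj)
  dsimp only at this
  exact this

end bundled

/-- unbundled Ext -/
abbrev X (M K : Type) [AddCommGroup M] [Module R M] [AddCommGroup K] [Module R K] (j : ℕ) : Type :=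
  Ext (ModuleCat.of R M) (ModuleCat.of R K) j

section
variable {A B C : Type} [AddCommGroup A] [Module R A] [AddCommGroup B] [Module R B]
    [AddCommGroup C] [Module R C] {f : A →ₗ[R] B} {g : B →ₗ[R] C}
    (K : Type) [AddCommGroup K] [Module R K] (j : ℕ)

/-- functoriality -/
noncomputable def Xm (f : A →ₗ[R] B) : X (R := R) B K j →ₗ[R] X (R := R) A K j :=
  (Ext.mk₀ (ModuleCat.ofHom f)).precompOfLinear R (ModuleCat.of R K) (zero_add j)

lemma Xm_apply (f : A →ₗ[R] B) (x : X (R := R) B K j) :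
    Xm K j f x = (Ext.mk₀ (ModuleCat.ofHom f)).comp x (zero_add j) := rfl

lemma Xm_comp (f : A →ₗ[R] B) (g : B →ₗ[R] C) (x : X (R := R) C K j) :
    Xm K j (g ∘ₗ f) x = Xm K j f (Xm K j g x) := by
  rw [Xm_apply, Xm_apply, Xm_apply, Ext.mk₀_comp_mk₀_assoc]
  rfl

/-- connecting -/
noncomputable def Xd (h : SES f g) : X (R := R) A K j →ₗ[R] X (R := R) C K (j+1) :=
  (h.se.extClass).precompOfLinear R (ModuleCat.of R K) (add_comm 1 j)

lemma X_exact₁ (h : SES f g) : Function.Exact (Xm K j f) (Xd K j h) := by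
  intro x
  constructor
  · intro hx
    exact cex₁ _ h.se (add_comm 1 j) x hx
  · rintro ⟨y, rfl⟩
    exact c_fd _ h.se (add_comm 1 j) y

lemma X_ex₃ (h : SES f g) (x : X (R := R) C K (j+1)) (hx : Xm K (j+1) g x = 0) :
    ∃ y, Xd K j h y = x := 
  cex₃ _ h.se (add_comm 1 j) x hx

lemma X_ex₂ (h : SES f g) (x : X (R := R) B K j) (hx : Xm K j f x = 0) :
    ∃ y, Xm K j g y = x := 
  cex₂ _ h.se x hx

lemma X_proj (k : ℕ) : Subsingleton (X (R := R) (Fin k → R) K (j+1)) := by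
  have : Projective (ModuleCat.of R (Fin k → R)) := inferInstance
  exact subsingleton_of_forall_eq 0 fun x => Ext.eq_zero_of_projective x

/-- hom -/
noncomputable def homX : (A →ₗ[R] K) ≃ₗ[R] X (R := R) A K 0 :=
  ((Ext.linearEquiv₀ (R := R)).trans (ModuleCat.homLinearEquiv (S := R))).symm

lemma homX_apply (f : A →ₗ[R] K) : homX K f = Ext.mk₀ (ModuleCat.ofHom f) := rfl

lemma Xm_homX (f : A →ₗ[R] B) (g : B →ₗ[R] K) : Xm K 0 f (homX K g) = homX K (g ∘ₗ f) := by
  rw [homX_apply, homX_apply, Xm_apply, Ext.mk₀_comp_mk₀]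
  rfl

end

lemma coker_iso {P Q S P' Q' S' : Type} [AddCommGroup P] [Module R P] [AddCommGroup Q] [Module R Q]
    [AddCommGroup S] [Module R S] [AddCommGroup P'] [Module R P'] [AddCommGroup Q'] [Module R Q']
    [AddCommGroup S'] [Module R S'] (u : P →ₗ[R] Q) (v : Q →ₗ[R] S) (u' : P' →ₗ[R] Q')
    (v' : Q' →ₗ[R] S') (h : Function.Exact u v) (hv : Function.Surjective v)
    (h' : Function.Exact u' v') (hv' : Function.Surjective v') (p : P →ₗ[R] P')
    (hp : Function.Surjective p) (q : Q ≃ₗ[R] Q') (hc : ∀ x, q (u x) = u' (p x)) :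
    Nonempty (S ≃ₗ[R] S') := by
  have hk : Submodule.map q.toLinearMap (LinearMap.ker v) = LinearMap.ker v' := by
    ext y
    constructor
    · rintro ⟨x, hx, rfl⟩
      obtain ⟨z, rfl⟩ := (h x).1 hx
      exact (h' _).2 ⟨p z, (hc z).symm⟩
    · intro hy
      obtain ⟨z', rfl⟩ := (h' y).1 hy
      obtain ⟨z, rfl⟩ := hp z'
      exact ⟨u z, (h _).2 ⟨z, rfl⟩, hc z⟩
  exact ⟨(v.quotKerEquivOfSurjective hv).symm.trans
    ((Submodule.Quotient.equiv _ _ q hk).trans (v'.quotKerEquivOfSurjective hv'))⟩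

lemma desc {P Q S : Type} [AddCommGroup P] [Module R P] [AddCommGroup Q] [Module R Q]
    [AddCommGroup S] [Module R S] (g : P →ₗ[R] Q) (hg : Function.Surjective g) (φ : P →ₗ[R] S)
    (h : ∀ x, g x = 0 → φ x = 0) : ∃ ψ : Q →ₗ[R] S, ψ ∘ₗ g = φ := by
  refine ⟨(LinearMap.ker g).liftQ φ h ∘ₗ (g.quotKerEquivOfSurjective hg).symm.toLinearMap, ?_⟩
  apply LinearMap.ext; intro x
  have : (g.quotKerEquivOfSurjective hg).symm (g x) = (LinearMap.ker g).mkQ x := by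
    rw [LinearEquiv.symm_apply_eq]; rfl
  rw [LinearMap.comp_apply, LinearMap.comp_apply, LinearEquiv.coe_coe, this]
  rfl

section phi
variable (I : Ideal R) (c : ℕ) (E : Type) [AddCommGroup E] [Module R E]

/-- canonical module -/
abbrev Kc : Type := H I c R →ₗ[R] E

/-- comparison -/
noncomputable def Phi (N : Type) [AddCommGroup N] [Module R N] :
    (H I c N →ₗ[R] E) →ₗ[R] (N →ₗ[R] Kc I c E) where
  toFun φ :=
    { toFun := fun n => φ ∘ₗ Hm I c (LinearMap.toSpanSingleton R N n)
      map_add' := by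
        intro n m
        rw [LinearMap.toSpanSingleton_add, Hm_add, LinearMap.comp_add]
      map_smul' := by
        intro r n
        rw [LinearMap.toSpanSingleton_smul, Hm_smul, LinearMap.comp_smul]
        rfl }
  map_add' φ ψ := rfl
  map_smul' r φ := rfl

variable {I c E}

lemma Phi_apply {N : Type} [AddCommGroup N] [Module R N] (φ : H I c N →ₗ[R] E) (n : N) :
    Phi I c E N φ n = φ ∘ₗ Hm I c (LinearMap.toSpanSingleton R N n) := rfl

lemma Phi_nat {M N : Type} [AddCommGroup M] [Module R M] [AddCommGroup N] [Module R N]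
    (g : M →ₗ[R] N) (φ : H I c N →ₗ[R] E) :
    Phi I c E M (φ ∘ₗ Hm I c g) = Phi I c E N φ ∘ₗ g := by
  apply LinearMap.ext; intro n
  rw [LinearMap.comp_apply, Phi_apply, Phi_apply, LinearMap.comp_assoc, ← Hm_comp,
    LinearMap.comp_toSpanSingleton]

lemma Phi_free (k : ℕ) : Function.Bijective (Phi I c E (Fin k → R)) := by
  constructor
  · rw [injective_iff_map_eq_zero]
    intro φ hφ
    apply LinearMap.ext; intro z
    rw [H_free_decomp I c k z, map_sum]
    refine Finset.sum_eq_zero fun j _ => ?_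
    have := LinearMap.congr_fun hφ (Pi.single j 1)
    have := LinearMap.congr_fun this (Hm I c (prj j) z)
    have e : LinearMap.toSpanSingleton R (Fin k → R) (Pi.single j 1) = inc j := by
      ext; simp
    rw [Phi_apply, e] at this
    exact this
  · intro ψ
    refine ⟨∑ j, ψ (Pi.single j 1) ∘ₗ Hm I c (prj j), ?_⟩
    apply LinearMap.ext; intro v
    rw [Phi_apply]
    have : v = ∑ j, v j • Pi.single j (1 : R) := pi_eq_sum_univ' v
    conv_rhs => rw [this, map_sum]
    have e2 : ∀ w : H I c R →ₗ[R] H I c (Fin k → R), (∑ j, ψ (Pi.single j 1) ∘ₗ Hm I c (prj j)) ∘ₗ w =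
        ∑ j, (ψ (Pi.single j 1) ∘ₗ Hm I c (prj j)) ∘ₗ w := by
      intro w
      apply LinearMap.ext; intro z
      simp only [LinearMap.comp_apply, LinearMap.sum_apply]
    rw [e2]
    refine Finset.sum_congr rfl fun j _ => ?_
    have e : prj j ∘ₗ LinearMap.toSpanSingleton R (Fin k → R) v = v j • LinearMap.id := by
      ext; simp
    rw [LinearMap.comp_assoc, ← Hm_comp, e, Hm_smul, Hm_id, map_smul, LinearMap.comp_smul,
      LinearMap.comp_id]

variable [IsNoetherianRing R] (h : ∀ i, i ≠ c → Subsingleton (H I i R))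

lemma Hm_surj (h : ∀ i, i ≠ c → Subsingleton (H I i R)) {M N : Type} [AddCommGroup M] [Module R M]
    [AddCommGroup N] [Module R N] [Module.Finite R M]
    (g : M →ₗ[R] N) (hg : Function.Surjective g) : Function.Surjective (Hm I c g) := by
  intro z
  refine (H_exact₃ I c (ses_ker hg) z).1 ?_
  have := H_top I c h (LinearMap.ker g) (c+1) (by omega)
  exact Subsingleton.elim _ _

lemma Phi_inj (h : ∀ i, i ≠ c → Subsingleton (H I i R)) (N : Type) [AddCommGroup N] [Module R N]
    [Module.Finite R N] : Function.Injective (Phi I c E N) := by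
  rw [injective_iff_map_eq_zero]
  intro φ hφ
  obtain ⟨k, g, hg⟩ := Module.Finite.exists_fin' R N
  have h1 : φ ∘ₗ Hm I c g = 0 := by
    apply (Phi_free k).1
    rw [Phi_nat, hφ, LinearMap.zero_comp, map_zero]
  apply LinearMap.ext; intro z
  obtain ⟨y, rfl⟩ := Hm_surj h g hg z
  exact LinearMap.congr_fun h1 y

lemma Phi_surj (h : ∀ i, i ≠ c → Subsingleton (H I i R)) (N : Type) [AddCommGroup N] [Module R N]
    [Module.Finite R N] : Function.Surjective (Phi I c E N) := by
  intro ψ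
  obtain ⟨k, g, hg⟩ := Module.Finite.exists_fin' R N
  obtain ⟨φ', hφ'⟩ := (Phi_free (I := I) (c := c) (E := E) k).2 (ψ ∘ₗ g)
  have h1 : φ' ∘ₗ Hm I c (LinearMap.ker g).subtype = 0 := by
    apply Phi_inj h
    rw [Phi_nat, hφ', map_zero]
    apply LinearMap.ext; intro x
    have : g x = 0 := x.2
    exact (congrArg ψ this).trans (map_zero ψ)
  obtain ⟨φ, hφ⟩ := desc (Hm I c g) (Hm_surj h g hg) φ' (by
    intro x hx
    obtain ⟨y, rfl⟩ := (H_exact₂ I c (ses_ker hg) x).1 hx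
    exact LinearMap.congr_fun h1 y)
  refine ⟨φ, ?_⟩
  apply LinearMap.ext; intro n
  obtain ⟨v, rfl⟩ := hg n
  have := LinearMap.congr_fun (Phi_nat g φ) v
  rw [hφ, hφ'] at this
  exact this.symm

/-- base case -/
noncomputable def Psi (h : ∀ i, i ≠ c → Subsingleton (H I i R)) (N : Type) [AddCommGroup N]
    [Module R N] [Module.Finite R N] :
    X (R := R) N (Kc I c E) 0 ≃ₗ[R] (H I c N →ₗ[R] E) :=
  ((LinearEquiv.ofBijective (Phi I c E N) ⟨Phi_inj h N, Phi_surj h N⟩).trans (homX _)).symm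

lemma Psi_nat (h : ∀ i, i ≠ c → Subsingleton (H I i R)) {M N : Type} [AddCommGroup M] [Module R M]
    [AddCommGroup N] [Module R N] [Module.Finite R M] [Module.Finite R N]
    (g : M →ₗ[R] N) (x : X (R := R) N (Kc I c E) 0) :
    Psi h M (Xm _ 0 g x) = Psi h N x ∘ₗ Hm I c g := by
  obtain ⟨φ, rfl⟩ := (Psi h N).symm.surjective x
  rw [LinearEquiv.apply_symm_apply, ← LinearEquiv.eq_symm_apply]
  change Xm _ 0 g (homX _ (Phi I c E N φ)) = homX _ (Phi I c E M _)
  rw [Phi_nat, Xm_homX]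

end phi
end RelCM

namespace RelCM
open Abelian
variable {R : Type} [CommRing R]

lemma dual_exact {A B C : Type} [AddCommGroup A] [Module R A] [AddCommGroup B] [Module R B]
    [AddCommGroup C] [Module R C] (E : Type) [AddCommGroup E] [Module R E] [hE : Module.Injective R E]
    (u : A →ₗ[R] B) (v : B →ₗ[R] C) (h : Function.Exact u v) :
    Function.Exact (LinearMap.lcomp R E v) (LinearMap.lcomp R E u) := by
  intro φ
  constructor
  · intro hφ
    obtain ⟨ψ, hψ⟩ := desc v.rangeRestrict v.surjective_rangeRestrict φ (by
      intro x hx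
      obtain ⟨y, rfl⟩ := (h x).1 (congrArg Subtype.val hx)
      exact LinearMap.congr_fun hφ y)
    obtain ⟨χ, hχ⟩ := hE.out (LinearMap.range v).subtype (Submodule.subtype_injective _) ψ
    refine ⟨χ, ?_⟩
    apply LinearMap.ext; intro x
    have := LinearMap.congr_fun hψ x
    rw [← this]
    exact hχ (v.rangeRestrict x)
  · rintro ⟨ψ, rfl⟩
    apply LinearMap.ext; intro x
    exact (congrArg ψ (h.apply_apply_eq_zero x)).trans (map_zero ψ)

lemma dual_surj {A B : Type} [AddCommGroup A] [Module R A] [AddCommGroup B] [Module R B]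
    (E : Type) [AddCommGroup E] [Module R E] [hE : Module.Injective R E]
    (u : A →ₗ[R] B) (h : Function.Injective u) :
    Function.Surjective (LinearMap.lcomp R E u) := by
  intro φ
  obtain ⟨ψ, hψ⟩ := hE.out u h φ
  exact ⟨ψ, LinearMap.ext hψ⟩

lemma dual_coker {P Q S A B C : Type} [AddCommGroup P] [Module R P] [AddCommGroup Q] [Module R Q]
    [AddCommGroup S] [Module R S] [AddCommGroup A] [Module R A] [AddCommGroup B] [Module R B]
    [AddCommGroup C] [Module R C] (E : Type) [AddCommGroup E] [Module R E] [Module.Injective R E]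
    (u : P →ₗ[R] Q) (v : Q →ₗ[R] S)
    (h : Function.Exact u v) (hv : Function.Surjective v) (d : C →ₗ[R] A) (m : A →ₗ[R] B)
    (h' : Function.Exact d m) (hd : Function.Injective d) (p : P →ₗ[R] (B →ₗ[R] E))
    (hp : Function.Surjective p) (q : Q ≃ₗ[R] (A →ₗ[R] E)) (hc : ∀ x, q (u x) = p x ∘ₗ m) :
    Nonempty (S ≃ₗ[R] (C →ₗ[R] E)) :=
  coker_iso u v (LinearMap.lcomp R E m) (LinearMap.lcomp R E d) h hv (dual_exact E _ _ h')
    (dual_surj E d hd) p hp q hc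

section
variable {I : Ideal R} {c : ℕ} {E : Type} [AddCommGroup E] [Module R E] 

lemma Hd_inj {A B C : Type} [AddCommGroup A] [Module R A] [AddCommGroup B] [Module R B]
    [AddCommGroup C] [Module R C] {f : A →ₗ[R] B} {g : B →ₗ[R] C} (h : SES f g) (I : Ideal R) (i : ℕ)
    (hB : Subsingleton (H I i B)) : Function.Injective (Hd I i h) := by
  rw [injective_iff_map_eq_zero]
  intro z hz
  obtain ⟨y, rfl⟩ := H_ex₃ I i h z hz
  rw [Subsingleton.elim y 0, map_zero]

lemma dual_step [Module.Injective R E] (h : ∀ i, i ≠ c → Subsingleton (H I i R))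
    {N : Type} [AddCommGroup N] [Module R N] {k : ℕ} (g : (Fin k → R) →ₗ[R] N)
    (hg : Function.Surjective g) (i j : ℕ) (hi : i ≠ c)
    (p : X (R := R) (Fin k → R) (Kc I c E) j →ₗ[R] (H I (i+1) (Fin k → R) →ₗ[R] E))
    (hp : Function.Surjective p)
    (q : X (R := R) (LinearMap.ker g) (Kc I c E) j ≃ₗ[R] (H I (i+1) (LinearMap.ker g) →ₗ[R] E))
    (hc : ∀ x, q (Xm _ j (LinearMap.ker g).subtype x) = p x ∘ₗ Hm I (i+1) (LinearMap.ker g).subtype) :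
    Nonempty (X (R := R) N (Kc I c E) (j+1) ≃ₗ[R] (H I i N →ₗ[R] E)) := by
  have hS := ses_ker hg
  have hF := H_free I i k (h i hi)
  have hinj : Function.Injective (Hd I i hS) := Hd_inj hS I i hF
  have hsurj : Function.Surjective (Xd (Kc I c E) j hS) := by
    intro x
    have := X_proj (R := R) (Kc I c E) j k
    exact X_ex₃ _ j hS x (Subsingleton.elim _ _)
  have e1 := X_exact₁ (Kc I c E) j hS
  have e2 := H_exact₁ I i hS
  exact dual_coker E _ _ e1 hsurj _ _ e2 hinj p hp q hc

variable [IsNoetherianRing R]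

lemma dual_main [Module.Injective R E] (h : ∀ i, i ≠ c → Subsingleton (H I i R)) (j : ℕ) :
    ∀ (N : Type) [AddCommGroup N] [Module R N] [Module.Finite R N] (i : ℕ), i + j = c →
      Nonempty (X (R := R) N (Kc I c E) j ≃ₗ[R] (H I i N →ₗ[R] E)) := by
  induction j with
  | zero =>
    intro N _ _ _ i hi
    obtain rfl : i = c := by omega
    exact ⟨Psi h N⟩
  | succ j ih =>
    intro N _ _ _ i hi
    obtain ⟨k, g, hg⟩ := Module.Finite.exists_fin' R N
    rcases Nat.eq_zero_or_pos j with rfl | hj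
    · obtain rfl : i + 1 = c := by omega
      exact dual_step h g hg i 0 (by omega) (Psi h (Fin k → R)).toLinearMap (Psi h _).surjective
        (Psi h _) (fun x => Psi_nat h _ x)
    · obtain ⟨q⟩ := ih (LinearMap.ker g) (i + 1) (by omega)
      obtain ⟨j, rfl⟩ : ∃ j', j = j' + 1 := ⟨j - 1, by omega⟩
      have h1 := X_proj (R := R) (Kc I c E) j k
      have h2 := H_free I (i+1) k (h (i+1) (by omega))
      refine dual_step h g hg i (j+1) (by omega) 0 ?_ q ?_
      · intro φ
        refine ⟨0, ?_⟩
        apply LinearMap.ext; intro z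
        rw [Subsingleton.elim z 0, map_zero, map_zero]
      · intro x
        rw [Subsingleton.elim x 0, map_zero, map_zero, map_zero, LinearMap.zero_comp]

lemma X_vanish_step {N : Type} [AddCommGroup N] [Module R N] {k : ℕ} (g : (Fin k → R) →ₗ[R] N)
    (hg : Function.Surjective g) (K : Type) [AddCommGroup K] [Module R K] (j : ℕ)
    (hs : Function.Surjective (Xm K j (LinearMap.ker g).subtype)) :
    Subsingleton (X (R := R) N K (j+1)) := by
  refine subsingleton_of_forall_eq 0 fun x => ?_
  have := X_proj (R := R) K j k
  obtain ⟨y, rfl⟩ := X_ex₃ K j (ses_ker hg) x (Subsingleton.elim _ _)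
  exact (X_exact₁ K j (ses_ker hg) y).2 (hs y)

lemma dual_vanish₁ [Module.Injective R E] (h : ∀ i, i ≠ c → Subsingleton (H I i R))
    (N : Type) [AddCommGroup N] [Module R N] [Module.Finite R N] :
    Subsingleton (X (R := R) N (Kc I c E) (c+1)) := by
  obtain ⟨k, g, hg⟩ := Module.Finite.exists_fin' R N
  refine X_vanish_step g hg _ c ?_
  rcases Nat.eq_zero_or_pos c with rfl | hc
  · intro x
    obtain ⟨ψ, hψ⟩ := dual_surj E _ (H_inj₀ I (ses_ker hg)) (Psi h _ x)
    refine ⟨(Psi h _).symm ψ, ?_⟩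
    apply (Psi h _).injective
    rw [Psi_nat, LinearEquiv.apply_symm_apply]
    exact hψ
  · intro x
    refine ⟨0, ?_⟩
    have h2 := H_free I 0 k (h 0 (by omega))
    have h3 : Subsingleton (H I 0 (LinearMap.ker g)) := (H_inj₀ I (ses_ker hg)).subsingleton
    obtain ⟨q⟩ := dual_main (E := E) h c (LinearMap.ker g) 0 (by omega)
    apply q.injective
    apply LinearMap.ext; intro z
    rw [Subsingleton.elim z 0, map_zero, map_zero]

lemma dual_vanish [Module.Injective R E] (h : ∀ i, i ≠ c → Subsingleton (H I i R)) (d : ℕ) :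
    ∀ (N : Type) [AddCommGroup N] [Module R N] [Module.Finite R N],
    Subsingleton (X (R := R) N (Kc I c E) (c+1+d)) := by
  induction d with
  | zero => intro N _ _ _; exact dual_vanish₁ h N
  | succ d ih =>
    intro N _ _ _
    obtain ⟨k, g, hg⟩ := Module.Finite.exists_fin' R N
    refine X_vanish_step g hg _ (c+1+d) ?_
    intro x
    have := ih (LinearMap.ker g)
    exact ⟨0, Subsingleton.elim _ _⟩

end
end RelCM

namespace RelCM
open Abelian
variable {R : Type} [CommRing R]

section bundled
variable {X Y Z : ModuleCat.{0} R} {f : X ⟶ Y} {g : Y ⟶ Z} (w : f ≫ g = 0)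

lemma vex₁ (h : (ShortComplex.mk f g w).ShortExact) {N : ModuleCat.{0} R} {j j' : ℕ} (hj : j + 1 = j')
    (x : Ext N X j') (hx : x.comp (Ext.mk₀ f) (add_zero j') = 0) :
    ∃ y : Ext N Z j, y.comp h.extClass hj = x := by
  have := fun hx => Ext.covariant_sequence_exact₁ _ h x hx hj
  dsimp only at this
  exact this hx

lemma vex₃ (h : (ShortComplex.mk f g w).ShortExact) {N : ModuleCat.{0} R} {j j' : ℕ} (hj : j + 1 = j')
    (x : Ext N Z j) (hx : x.comp h.extClass hj = 0) :
    ∃ y : Ext N Y j, y.comp (Ext.mk₀ g) (add_zero j) = x := by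
  have := Ext.covariant_sequence_exact₃ _ h x hj
  dsimp only at this
  exact this hx
end bundled

lemma injdim (n : ℕ) : ∀ (K : Type) [AddCommGroup K] [Module R K],
    (∀ L : Ideal R, Subsingleton (X (R := R) (R ⧸ L) K (n+1))) →
    ∀ (j : ℕ), n < j → ∀ N : ModuleCat.{0} R, Subsingleton (Ext N (ModuleCat.of R K) j) := by
  induction n with
  | zero =>
    intro K _ _ h j hj N
    have hb : Module.Injective R K := by
      apply Module.Baer.injective
      intro L g
      have := h L
      obtain ⟨y, hy⟩ := (X_exact₁ K 0 (ses_mkQ L) (homX K g)).1 (Subsingleton.elim _ _)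
      obtain ⟨g', rfl⟩ := (homX (R := R) K).surjective y
      rw [Xm_homX] at hy
      refine ⟨g', fun x hx => ?_⟩
      exact LinearMap.congr_fun ((homX (R := R) K).injective hy) ⟨x, hx⟩
    have : CategoryTheory.Injective (ModuleCat.of R K) :=
      Module.injective_object_of_injective_module R K
    obtain ⟨j, rfl⟩ : ∃ j', j = j' + 1 := ⟨j - 1, by omega⟩
    exact subsingleton_of_forall_eq 0 fun x => Ext.eq_zero_of_injective x
  | succ n ih =>
    intro K _ _ h j hj N
    let J : ModuleCat.{0} R := Injective.under (ModuleCat.of R K)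
    let g : K →ₗ[R] J := (Injective.ι (ModuleCat.of R K)).hom
    have hg : Function.Injective g :=
      (ModuleCat.mono_iff_injective (Injective.ι (ModuleCat.of R K))).1 inferInstance
    have hJ : CategoryTheory.Injective (ModuleCat.of R J) :=
      inferInstanceAs (CategoryTheory.Injective J)
    have hS := ses_range hg
    have hQ := ih (J ⧸ LinearMap.range g) (by
      intro L
      have := h L
      refine subsingleton_of_forall_eq 0 fun x => ?_
      obtain ⟨y, rfl⟩ := vex₃ _ hS.se rfl x (Subsingleton.elim _ _)
      rw [Ext.eq_zero_of_injective y, Ext.zero_comp])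
    obtain ⟨j, rfl⟩ : ∃ j', j = j' + 1 := ⟨j - 1, by omega⟩
    have := hQ j (by omega) N
    refine subsingleton_of_forall_eq 0 fun x => ?_
    obtain ⟨y, rfl⟩ := vex₁ _ hS.se rfl x (Ext.eq_zero_of_injective _)
    rw [Subsingleton.elim y 0, Ext.zero_comp]

lemma exists_dual_ne [IsLocalRing R] {E : Type} [AddCommGroup E] [Module R E]
    [hE : Module.Injective R E] (f : IsLocalRing.ResidueField R →ₗ[R] E) (hf : Function.Injective f)
    {M : Type} [AddCommGroup M] [Module R M] (y : M) (hy : y ≠ 0) : ∃ φ : M →ₗ[R] E, φ y ≠ 0 := by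
  let s := LinearMap.toSpanSingleton R M y
  let f0 : R →ₗ[R] E := f ∘ₗ Algebra.linearMap R (IsLocalRing.ResidueField R)
  obtain ⟨ψ, hψ⟩ := desc s.rangeRestrict s.surjective_rangeRestrict f0 (by
    intro r hr
    have h1 : r • y = 0 := congrArg Subtype.val hr
    have h2 : algebraMap R (IsLocalRing.ResidueField R) r = 0 := by
      rw [IsLocalRing.ResidueField.algebraMap_eq, IsLocalRing.residue_eq_zero_iff]
      intro hu
      exact hy ((hu.smul_eq_zero).1 h1)
    exact (congrArg f h2).trans (map_zero f))
  obtain ⟨χ, hχ⟩ := hE.out (LinearMap.range s).subtype (Submodule.subtype_injective _) ψ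
  refine ⟨χ, fun h0 => ?_⟩
  have h1 := hχ (s.rangeRestrict 1)
  have h2 := LinearMap.congr_fun hψ 1
  have h3 : (LinearMap.range s).subtype (s.rangeRestrict 1) = y := one_smul R y
  rw [h3, h0] at h1
  have h4 : f0 1 = 0 := by rw [← h2]; exact h1.symm
  have h5 : algebraMap R (IsLocalRing.ResidueField R) 1 = 0 := hf (h4.trans (map_zero f).symm)
  rw [map_one] at h5
  exact one_ne_zero h5

lemma Xm_inj_zero {A B : Type} [AddCommGroup A] [Module R A] [AddCommGroup B] [Module R B]
    (K : Type) [AddCommGroup K] [Module R K]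
    (g : A →ₗ[R] B) (hg : Function.Surjective g) (x : X (R := R) B K 0) (hx : Xm K 0 g x = 0) : x = 0 := by
  obtain ⟨φ, rfl⟩ := (homX (R := R) K).surjective x
  rw [Xm_homX] at hx
  have h1 : φ ∘ₗ g = 0 := (homX (R := R) K).injective (hx.trans (map_zero _).symm)
  have : φ = 0 := by
    apply LinearMap.ext; intro b
    obtain ⟨a, rfl⟩ := hg b
    exact LinearMap.congr_fun h1 a
  rw [this, map_zero]

section
variable {I : Ideal R} {c : ℕ} {E : Type} [AddCommGroup E] [Module R E] [IsNoetherianRing R]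

lemma tors_quot (I : Ideal R) (n : ℕ) : Tors I (R ⧸ I ^ n) := by
  intro x
  refine ⟨n, fun r hr => ?_⟩
  obtain ⟨x, rfl⟩ := Submodule.mkQ_surjective _ x
  rw [← map_smul]
  exact (Submodule.Quotient.mk_eq_zero _).2 (Ideal.mul_mem_right _ _ hr)

lemma Tors.sub {N : Type} [AddCommGroup N] [Module R N] (h : Tors I N)
    (P : Submodule R N) : Tors I P := by
  rintro ⟨y, hy⟩
  obtain ⟨n, hn⟩ := h y
  exact ⟨n, fun r hr => Subtype.ext (hn r hr)⟩

lemma X_tors_zero [Module.Injective R E] (h : ∀ i, i ≠ c → Subsingleton (H I i R))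
    (N : Type) [AddCommGroup N] [Module R N] [Module.Finite R N] (hN : Tors I N)
    (i : ℕ) (hi : i ≠ c) : Subsingleton (X (R := R) N (Kc I c E) i) := by
  rcases lt_or_gt_of_ne hi with hi | hi
  · obtain ⟨d, rfl⟩ : ∃ d, c = (d + 1) + i := ⟨c - i - 1, by omega⟩
    obtain ⟨q⟩ := dual_main (E := E) h i N (d + 1) rfl
    have := lc_tors I d N hN
    have : Subsingleton (H I (d+1) N →ₗ[R] E) := by
      refine subsingleton_of_forall_eq 0 fun φ => ?_
      apply LinearMap.ext; intro z
      rw [Subsingleton.elim z 0, map_zero, map_zero]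
    exact q.toEquiv.subsingleton
  · obtain ⟨d, rfl⟩ : ∃ d, i = c + 1 + d := ⟨i - c - 1, by omega⟩
    exact dual_vanish h d N

lemma H_K_zero [Module.Injective R E] (h : ∀ i, i ≠ c → Subsingleton (H I i R))
    (i : ℕ) (hi : i ≠ c) : Subsingleton (H I i (Kc I c E)) := by
  refine subsingleton_of_forall_eq 0 fun z => ?_
  obtain ⟨n, x, rfl⟩ := exists_lof z
  have := X_tors_zero (E := E) h (R ⧸ I ^ n) (tors_quot I n) i hi
  rw [Subsingleton.elim x 0, map_zero]

lemma X_tors_dual [Module.Injective R E] (h : ∀ i, i ≠ c → Subsingleton (H I i R))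
    (N : Type) [AddCommGroup N] [Module R N] [Module.Finite R N] (hN : Tors I N) :
    Nonempty (X (R := R) N (Kc I c E) c ≃ₗ[R] (N →ₗ[R] E)) := by
  obtain ⟨q⟩ := dual_main (E := E) h c N 0 (zero_add c)
  let e : H I 0 N ≃ₗ[R] N := LinearEquiv.ofBijective (ev I (ModuleCat.of R N)) ⟨ev_inj I _, ev_surj I _ hN⟩
  exact ⟨q.trans (LinearEquiv.congrLeft E R e)⟩

lemma etr_inj [Module.Injective R E] (h : ∀ i, i ≠ c → Subsingleton (H I i R))
    {A B : Type} [AddCommGroup A] [Module R A] [AddCommGroup B] [Module R B] [Module.Finite R A]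
    (hA : Tors I A) (g : A →ₗ[R] B) (hg : Function.Surjective g)
    (x : X (R := R) B (Kc I c E) c) (hx : Xm _ c g x = 0) : x = 0 := by
  rcases Nat.eq_zero_or_pos c with rfl | hc
  · exact Xm_inj_zero _ g hg x hx
  · obtain ⟨c, rfl⟩ : ∃ d, c = d + 1 := ⟨c - 1, by omega⟩
    obtain ⟨y, rfl⟩ := X_ex₃ _ c (ses_ker hg) x hx
    have := X_tors_zero (E := E) h (LinearMap.ker g) (hA.sub _) c (by omega)
    rw [Subsingleton.elim y 0, map_zero]

lemma H_K_nontrivial [IsLocalRing R] [Module.Injective R E]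
    (h : ∀ i, i ≠ c → Subsingleton (H I i R)) (hI : I ≠ ⊤)
    (f : IsLocalRing.ResidueField R →ₗ[R] E) (hf : Function.Injective f) :
    Nontrivial (H I c (Kc I c E)) := by
  by_contra hn
  rw [not_nontrivial_iff_subsingleton] at hn
  have h1 : Subsingleton (X (R := R) (R ⧸ I ^ 1) (Kc I c E) c) := by
    refine subsingleton_of_forall_eq 0 fun x => ?_
    obtain ⟨n, hmn, hx⟩ := lof_eq_zero (Subsingleton.elim (lof I c (ModuleCat.of R (Kc I c E)) 1 x) 0)
    refine etr_inj h (tors_quot I n) (Submodule.mapQ (I ^ n) (I ^ 1) LinearMap.id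
      (Ideal.pow_le_pow_right hmn)) ?_ x hx
    intro y
    obtain ⟨y, rfl⟩ := Submodule.mkQ_surjective _ y
    exact ⟨Submodule.Quotient.mk y, rfl⟩
  obtain ⟨q⟩ := X_tors_dual (E := E) h (R ⧸ I ^ 1) (tors_quot I 1)
  obtain ⟨φ, hφ⟩ := exists_dual_ne f hf (Submodule.Quotient.mk 1 : R ⧸ I ^ 1) (by
    rw [Ne, Submodule.Quotient.mk_eq_zero, pow_one, ← Ideal.eq_top_iff_one]
    exact hI)
  have : φ = 0 := q.symm.injective (Subsingleton.elim _ _)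
  rw [this] at hφ
  exact hφ rfl

lemma K_faithful [IsLocalRing R] [Module.Injective R E]
    (h : ∀ i, i ≠ c → Subsingleton (H I i R)) (hI : I ≠ ⊤)
    (f : IsLocalRing.ResidueField R →ₗ[R] E) (hf : Function.Injective f) (r : R)
    (hr : ∀ y : Kc I c E, r • y = 0) : r = 0 := by
  by_contra hr0
  obtain ⟨n, hn⟩ : ∃ n, r ∉ I ^ n := by
    by_contra! hall
    apply hr0
    have := Ideal.iInf_pow_eq_bot_of_isLocalRing I hI
    have h1 : r ∈ ⨅ n, I ^ n := Submodule.mem_iInf _ |>.2 hall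
    rw [this] at h1
    exact h1
  obtain ⟨q⟩ := X_tors_dual (E := E) h (R ⧸ I ^ n) (tors_quot I n)
  obtain ⟨φ, hφ⟩ := exists_dual_ne f hf (Submodule.Quotient.mk r : R ⧸ I ^ n) (by
    rw [Ne, Submodule.Quotient.mk_eq_zero]
    exact hn)
  have h0 : r • 𝟙 (ModuleCat.of R (Kc I c E)) = 0 := by
    apply ModuleCat.hom_ext; apply LinearMap.ext; intro y
    exact hr y
  have h2 : ∀ x : X (R := R) (R ⧸ I ^ n) (Kc I c E) c, r • x = 0 := by
    intro x
    have : r • x = x.comp (Ext.mk₀ (r • 𝟙 (ModuleCat.of R (Kc I c E)))) (add_zero c) := by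
      simp [Ext.mk₀_smul]
    rw [this, h0, Ext.mk₀_zero, Ext.comp_zero]
  have h3 : r • φ = 0 := by
    apply q.symm.injective
    rw [map_smul, h2, map_zero]
  apply hφ
  have h4 := LinearMap.congr_fun h3 (Submodule.Quotient.mk 1 : R ⧸ I ^ n)
  rw [LinearMap.smul_apply, ← map_smul, ← Submodule.Quotient.mk_smul, smul_eq_mul, mul_one] at h4
  exact h4

lemma K_injdim [Module.Injective R E] (h : ∀ i, i ≠ c → Subsingleton (H I i R)) (j : ℕ) (hj : c < j)
    (N : ModuleCat.{0} R) : Subsingleton (Ext N (ModuleCat.of R (Kc I c E)) j) :=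
  injdim c (Kc I c E) (fun L => dual_vanish₁ h (R ⧸ L)) j hj N

end
end RelCM
namespace RelCM

lemma ext_subsingleton_of_iso {R : Type} [CommRing R] {N A B : ModuleCat.{0} R} (e : A ≅ B)
    (j : ℕ) (h : Subsingleton (Abelian.Ext N A j)) : Subsingleton (Abelian.Ext N B j) := by
  refine subsingleton_of_forall_eq 0 fun x => ?_
  have h1 : x.comp (Abelian.Ext.mk₀ e.inv) (add_zero j) = 0 := Subsingleton.elim _ _
  have h2 : (x.comp (Abelian.Ext.mk₀ e.inv) (add_zero j)).comp (Abelian.Ext.mk₀ e.hom)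
      (add_zero j) = x := by
    rw [Abelian.Ext.comp_assoc_of_second_deg_zero, Abelian.Ext.mk₀_comp_mk₀, e.inv_hom_id,
      Abelian.Ext.comp_mk₀_id]
  rw [← h2, h1, Abelian.Ext.zero_comp]

end RelCM

/-- Lemma 2.14: if `(R,𝔪)` is a relative Cohen-Macaulay local ring w.r.t. `𝔞` with
`c = cd(𝔞,R)`, then the cohomological canonical module `K^c_𝔞(R) = D_R(H^c_𝔞(R))` is a
faithful relative Cohen-Macaulay `R`-module w.r.t. `𝔞` of finite injective dimension. -/
theorem stmt13 {R : Type} [CommRing R] [IsNoetherianRing R] [IsLocalRing R]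
    (𝔞 : Ideal R) (h𝔞 : 𝔞 ≠ ⊤)
    (hCM : IsRelCM 𝔞 R)
    (c : ℕ) (hc : c = cohDim 𝔞 R)
    (E : Type) [AddCommGroup E] [Module R E]
    (f : IsLocalRing.ResidueField R →ₗ[R] E) (hE : IsInjectiveHull R f) :
    (∀ r : R,
        (∀ y : ((localCohomology 𝔞 c).obj (ModuleCat.of R R)) →ₗ[R] E, r • y = 0) → r = 0) ∧
      IsRelCM 𝔞 (((localCohomology 𝔞 c).obj (ModuleCat.of R R)) →ₗ[R] E) ∧
      HasFiniteInjectiveDimension R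
        (((localCohomology 𝔞 c).obj (ModuleCat.of R R)) →ₗ[R] E) := by
  obtain ⟨c0, hc0⟩ := hCM
  have hset : {i : ℕ | Nontrivial ((localCohomology 𝔞 i).obj (ModuleCat.of R R))} = {c0} := by
    ext i
    exact hc0 i
  have hcc : c = c0 := by
    rw [hc, cohDim, hset, csSup_singleton]
  subst hcc
  have h : ∀ i, i ≠ c → Subsingleton (RelCM.H 𝔞 i R) := by
    intro i hi
    rw [← not_nontrivial_iff_subsingleton]
    exact fun hn => hi ((hc0 i).1 ((RelCM.lcBridge_nontrivial 𝔞 i (ModuleCat.of R R)).2 hn))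
  haveI := hE.injective
  refine ⟨?_, ?_, ?_⟩
  · intro r hr
    refine RelCM.K_faithful h h𝔞 f hE.inj r fun y => ?_
    apply (RelCM.dualBridge 𝔞 c (ModuleCat.of R R) E).injective
    rw [map_smul, map_zero]
    exact hr _
  · refine ⟨c, fun i => ?_⟩
    rw [RelCM.lcBridge_nontrivial]
    have e := (RelCM.He 𝔞 i (RelCM.dualBridge 𝔞 c (ModuleCat.of R R) E)).toEquiv.nontrivial_congr
    refine e.symm.trans ⟨fun hn => ?_, fun hi => ?_⟩
    · by_contra hi
      have := RelCM.H_K_zero (E := E) h i hi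
      exact not_nontrivial_iff_subsingleton.2 this hn
    · subst hi
      exact RelCM.H_K_nontrivial h h𝔞 f hE.inj
  · refine ⟨c, fun j hj N => ?_⟩
    have h1 := RelCM.K_injdim (E := E) h j hj N
    have h2 := RelCM.ext_subsingleton_of_iso
      (RelCM.dualBridge 𝔞 c (ModuleCat.of R R) E).toModuleIso j h1
    exact (RelCM.oldNew N _ j).toEquiv.subsingleton_congr.2 h2
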